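/- The family B₁₃ spans the generic Hecke algebra H of G₁₃ as an R-module. -/

import Mathlib

noncomputable section

open scoped TensorProduct

/-- The Laurent polynomial ring `ℤ[a, b, b⁻¹, c, d, d⁻¹]`, realised as the monoid algebra of
`ℕ × ℕ × ℤ × ℤ` over `ℤ`; the four coordinates record the exponents of `a`, `c`, `b`, `d`
respectively (`b` and `d` are invertible, so their exponents range over all of `ℤ`). -/
abbrev Rr : Type := AddMonoidAlgebra ℤ (ℕ × ℕ × ℤ × ℤ)

namespace G13

/-- The indeterminate `a`. -/
def pa : Rr := AddMonoidAlgebra.single (1, 0, 0, 0) 1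
/-- The indeterminate `c`. -/
def pc : Rr := AddMonoidAlgebra.single (0, 1, 0, 0) 1
/-- The invertible indeterminate `b`. -/
def pb : Rr := AddMonoidAlgebra.single (0, 0, 1, 0) 1
/-- The invertible indeterminate `d`. -/
def pd : Rr := AddMonoidAlgebra.single (0, 0, 0, 1) 1
/-- `b⁻¹`. -/
def pbInv : Rr := AddMonoidAlgebra.single (0, 0, -1, 0) 1
/-- `d⁻¹`. -/
def pdInv : Rr := AddMonoidAlgebra.single (0, 0, 0, -1) 1

def fS : FreeAlgebra Rr (Fin 3) := FreeAlgebra.ι Rr 0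
def fT : FreeAlgebra Rr (Fin 3) := FreeAlgebra.ι Rr 1
def fU : FreeAlgebra Rr (Fin 3) := FreeAlgebra.ι Rr 2

/-- The defining relations of the generic Hecke algebra of `G₁₃`:
`tust = ustu`, `stust = ustus`, `s² = a·s + b`, `t² = c·t + d`, `u² = c·u + d`. -/
inductive Rel : FreeAlgebra Rr (Fin 3) → FreeAlgebra Rr (Fin 3) → Prop
  | braid1 : Rel (fT * fU * fS * fT) (fU * fS * fT * fU)
  | braid2 : Rel (fS * fT * fU * fS * fT) (fU * fS * fT * fU * fS)
  | relS : Rel (fS * fS)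
      (algebraMap Rr (FreeAlgebra Rr (Fin 3)) pa * fS + algebraMap Rr (FreeAlgebra Rr (Fin 3)) pb)
  | relT : Rel (fT * fT)
      (algebraMap Rr (FreeAlgebra Rr (Fin 3)) pc * fT + algebraMap Rr (FreeAlgebra Rr (Fin 3)) pd)
  | relU : Rel (fU * fU)
      (algebraMap Rr (FreeAlgebra Rr (Fin 3)) pc * fU + algebraMap Rr (FreeAlgebra Rr (Fin 3)) pd)

/-- The generic Hecke algebra of `G₁₃`. -/
abbrev H := RingQuot Rel

/-- The generator `s` of `H`. -/
def s : H := RingQuot.mkAlgHom Rr Rel fS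
/-- The generator `t` of `H`. -/
def t : H := RingQuot.mkAlgHom Rr Rel fT
/-- The generator `u` of `H`. -/
def u : H := RingQuot.mkAlgHom Rr Rel fU

/-- The central element `z = (stu)³`. -/
def z : H := (s * t * u) ^ 3

/-- Scalars of `Rr` viewed inside `H`. -/
def sc : Rr → H := algebraMap Rr H

/-- The twelve elements `E₁, …, E₁₂`: `1, u, s, ts, su, us, tu, tsu, tus, sts, stu, uts`. -/
def E : Fin 12 → H :=
  ![1, u, s, t * s, s * u, u * s, t * u, t * s * u, t * u * s, s * t * s, s * t * u, u * t * s]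

/-- The family `B₁₃ = (b₁, …, b₉₆)`, indexed here by `Fin 96` (so `B i = b_{i+1}`):
`b_{24k+12l+m} = z^k · E_m · t^l` for `k ∈ {0,…,3}`, `l ∈ {0,1}`, `m ∈ {1,…,12}`. -/
def B : Fin 96 → H := fun i =>
  z ^ (i.val / 24) * E ⟨i.val % 12, by omega⟩ * t ^ (i.val / 12 % 2)

/-! ### Defining relations in `H` and the generators as units -/

lemma map_sc (r : Rr) : RingQuot.mkAlgHom Rr Rel (algebraMap Rr (FreeAlgebra Rr (Fin 3)) r) =
    algebraMap Rr H r := AlgHom.commutes _ r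

lemma s_sq : s * s = pa • s + pb • (1 : H) := by
  have h := RingQuot.mkAlgHom_rel Rr Rel.relS
  simp only [map_mul, map_add, map_sc] at h
  rw [Algebra.smul_def, Algebra.smul_def, mul_one]
  exact h

lemma t_sq : t * t = pc • t + pd • (1 : H) := by
  have h := RingQuot.mkAlgHom_rel Rr Rel.relT
  simp only [map_mul, map_add, map_sc] at h
  rw [Algebra.smul_def, Algebra.smul_def, mul_one]
  exact h

lemma u_sq : u * u = pc • u + pd • (1 : H) := by
  have h := RingQuot.mkAlgHom_rel Rr Rel.relU
  simp only [map_mul, map_add, map_sc] at h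
  rw [Algebra.smul_def, Algebra.smul_def, mul_one]
  exact h

lemma braid1 : t * u * s * t = u * s * t * u := by
  have h := RingQuot.mkAlgHom_rel Rr Rel.braid1
  simp only [map_mul] at h
  exact h

lemma braid2 : s * t * u * s * t = u * s * t * u * s := by
  have h := RingQuot.mkAlgHom_rel Rr Rel.braid2
  simp only [map_mul] at h
  exact h

lemma pb_inv : pb * pbInv = 1 := by
  simp [pb, pbInv, AddMonoidAlgebra.single_mul_single, AddMonoidAlgebra.one_def]
  rfl

lemma pd_inv : pd * pdInv = 1 := by
  simp [pd, pdInv, AddMonoidAlgebra.single_mul_single, AddMonoidAlgebra.one_def]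
  rfl

/-- A solution of a quadratic equation with invertible constant term is a unit. -/
def quadUnit (x : H) (α β γ : Rr) (h : x * x = α • x + β • (1 : H)) (hb : β * γ = 1) : Hˣ where
  val := x
  inv := γ • (x + (-α) • (1 : H))
  val_inv := by
    rw [mul_smul_comm, mul_add, h, mul_smul_comm, mul_one, add_right_comm, ← add_smul,
      add_neg_cancel, zero_smul, zero_add, smul_smul, mul_comm, hb, one_smul]
  inv_val := by
    rw [smul_mul_assoc, add_mul, h, smul_mul_assoc, one_mul, add_right_comm, ← add_smul,
      add_neg_cancel, zero_smul, zero_add, smul_smul, mul_comm, hb, one_smul]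

/-- The unit `s`. -/
def sU : Hˣ := quadUnit s pa pb pbInv s_sq pb_inv
/-- The unit `t`. -/
def tU : Hˣ := quadUnit t pc pd pdInv t_sq pd_inv
/-- The unit `u`. -/
def uU : Hˣ := quadUnit u pc pd pdInv u_sq pd_inv
/-- The unit `δ = stu`. -/
def dU : Hˣ := sU * tU * uU
/-- The unit `z = δ³`. -/
def zU : Hˣ := dU ^ 3

lemma val_s : (sU : H) = s := rfl
lemma val_t : (tU : H) = t := rfl
lemma val_u : (uU : H) = u := rfl
lemma val_z : (zU : H) = z := rfl

lemma braid1U : tU * uU * sU * tU = uU * sU * tU * uU := Units.ext braid1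
lemma braid2U : sU * tU * uU * sU * tU = uU * sU * tU * uU * sU := Units.ext braid2

lemma t_eq : tU = uU * dU * uU * dU⁻¹ * uU⁻¹ := by
  rw [eq_mul_inv_iff_mul_eq, eq_mul_inv_iff_mul_eq]
  have h := congrArg (· * uU) braid1U
  simp only [dU, mul_assoc] at h ⊢
  exact h

lemma zu_comm : zU * uU = uU * zU := by
  have h2 : dU * dU * uU⁻¹ = uU * dU * sU := by
    have h := braid2U
    rw [mul_inv_eq_iff_eq_mul]
    have hh := congrArg (· * uU) h
    simp only [dU, mul_assoc] at hh ⊢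
    exact hh
  have h3 : sU = dU * uU⁻¹ * tU⁻¹ := by simp [dU, mul_assoc]
  have h4 : dU * dU * uU⁻¹ * tU = uU * dU * dU * uU⁻¹ := by
    rw [h2, h3]; simp [mul_assoc]
  rw [t_eq] at h4
  have h5 := congrArg (fun x => x * uU * dU) h4
  simp only [mul_assoc, inv_mul_cancel, mul_one, inv_mul_cancel_left] at h5
  simpa only [zU, pow_succ, pow_zero, one_mul, mul_assoc] using h5

lemma zd_comm : zU * dU = dU * zU := by
  rw [zU, pow_mul_comm']

lemma s_eq : sU = zU * dU⁻¹ * uU⁻¹ * dU⁻¹ * uU⁻¹ := by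
  have h3 : sU = dU * uU⁻¹ * tU⁻¹ := by simp [dU, mul_assoc]
  rw [h3, t_eq, zU]
  simp [mul_assoc, pow_succ]

/-! ### Normal forms of braid group elements -/

/-- Letters: `u`, `v = u⁻¹`, `d = δ`, `e = δ⁻¹`. -/
inductive Ltr : Type
  | u | v | d | e

namespace Ltr

/-- The value of a letter. -/
def val : Ltr → Hˣ
  | u => uU
  | v => uU⁻¹
  | d => dU
  | e => dU⁻¹

/-- The inverse letter. -/
def inv : Ltr → Ltr
  | u => v
  | v => u
  | d => e
  | e => d

/-- Boolean equality of letters. -/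
def eqb : Ltr → Ltr → Bool
  | u, u => true
  | v, v => true
  | d, d => true
  | e, e => true
  | _, _ => false

lemma eq_of_eqb {x y : Ltr} (h : eqb x y = true) : x = y := by
  cases x <;> cases y <;> first | rfl | cases h

lemma val_inv (x : Ltr) : x.inv.val = x.val⁻¹ := by
  cases x <;> simp [inv, val]

lemma comm (x : Ltr) : Commute zU x.val := by
  have hu : Commute zU uU := zu_comm
  have hd : Commute zU dU := zd_comm
  cases x
  · exact hu
  · exact hu.inv_right
  · exact hd
  · exact hd.inv_right

end Ltr

/-- Boolean equality of words. -/
def wordEqb : List Ltr → List Ltr → Bool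
  | [], [] => true
  | x :: l, y :: m => Ltr.eqb x y && wordEqb l m
  | _, _ => false

lemma eq_of_wordEqb : ∀ {l m : List Ltr}, wordEqb l m = true → l = m
  | [], [], _ => rfl
  | x :: l, y :: m, h => by
    simp only [wordEqb, Bool.and_eq_true] at h
    rw [Ltr.eq_of_eqb h.1, eq_of_wordEqb h.2]
  | [], _ :: _, h => by cases h
  | _ :: _, [], h => by cases h

/-- The product of a word. -/
def wordVal : List Ltr → Hˣ
  | [] => 1
  | x :: l => x.val * wordVal l

/-- The product of a word read from right to left. -/
def revVal : List Ltr → Hˣ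
  | [] => 1
  | x :: l => revVal l * x.val

lemma z_comm_rev (l : List Ltr) : Commute zU (revVal l) := by
  induction l with
  | nil => exact Commute.one_right _
  | cons x l ih => exact ih.mul_right x.comm

/-- An element `z^k · w` of the braid group; the word `w` is stored reversed. -/
structure Elt : Type where
  /-- exponent of `z` -/
  k : ℤ
  /-- reversed word -/
  w : List Ltr

/-- The value of an element. -/
def Elt.val (g : Elt) : Hˣ := zU ^ g.k * revVal g.w

/-- Boolean equality. -/
def Elt.eqb (g h : Elt) : Bool := decide (g.k = h.k) && wordEqb g.w h.w

lemma Elt.eq_of_eqb {g h : Elt} (H : g.eqb h = true) : g = h := by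
  cases g; cases h
  simp only [Elt.eqb, Bool.and_eq_true, decide_eq_true_eq] at H
  rw [H.1, eq_of_wordEqb H.2]

/-- Multiply on the right by a letter, using `u u⁻¹ = 1`, `δ δ⁻¹ = 1`, `δ² = z δ⁻¹`. -/
def Elt.push : Elt → Ltr → Elt
  | ⟨k, .v :: l⟩, .u => ⟨k, l⟩
  | ⟨k, .u :: l⟩, .v => ⟨k, l⟩
  | ⟨k, .e :: l⟩, .d => ⟨k, l⟩
  | ⟨k, .d :: l⟩, .e => ⟨k, l⟩
  | ⟨k, .d :: l⟩, .d => ⟨k + 1, .e :: l⟩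
  | ⟨k, .e :: l⟩, .e => ⟨k - 1, .d :: l⟩
  | ⟨k, l⟩, x => ⟨k, x :: l⟩

lemma Elt.push_val (g : Elt) (x : Ltr) : (g.push x).val = g.val * x.val := by
  have key : ∀ (k : ℤ) (l : List Ltr), zU ^ (k + 1) * (revVal l * dU⁻¹) =
      zU ^ k * (revVal l * dU * dU) := by
    intro k l
    rw [zpow_add_one, mul_assoc, ← mul_assoc zU, (z_comm_rev l).eq, zU]
    simp [pow_succ, mul_assoc]
  have key2 : ∀ (k : ℤ) (l : List Ltr), zU ^ (k - 1) * (revVal l * dU) =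
      zU ^ k * (revVal l * dU⁻¹ * dU⁻¹) := by
    intro k l
    have h := key (k - 1) l
    rw [sub_add_cancel] at h
    rw [← mul_assoc (zU ^ k), h]
    simp [mul_assoc]
  obtain ⟨k, l⟩ := g
  rcases l with _ | ⟨y, l⟩
  · cases x <;> simp [push, val, revVal]
  · cases y <;> cases x <;>
      first
        | (simp only [push, val, revVal, Ltr.val]; rw [key]; simp only [mul_assoc]; done)
        | (simp only [push, val, revVal, Ltr.val]; rw [key2]; simp only [mul_assoc]; done)
        | (simp [push, val, revVal, Ltr.val, mul_assoc]; done)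

/-- Multiply on the right by a word. -/
def Elt.mulWord : Elt → List Ltr → Elt
  | g, [] => g
  | g, x :: l => (g.push x).mulWord l

lemma Elt.mulWord_val (l : List Ltr) : ∀ g : Elt, (g.mulWord l).val = g.val * wordVal l := by
  induction l with
  | nil => intro g; simp [mulWord, wordVal]
  | cons x l ih => intro g; rw [mulWord, ih, push_val, wordVal, mul_assoc]

/-- Multiply on the right by the inverse of a word. -/
def Elt.mulInv : Elt → List Ltr → Elt
  | g, [] => g
  | g, x :: l => (g.mulInv l).push x.inv

lemma Elt.mulInv_val (g : Elt) (l : List Ltr) : (g.mulInv l).val = g.val * (wordVal l)⁻¹ := by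
  induction l with
  | nil => simp [mulInv, wordVal]
  | cons x l ih => rw [mulInv, push_val, ih, Ltr.val_inv, wordVal, mul_inv_rev, mul_assoc]

/-- Multiply on the right by a power of `z`. -/
def Elt.shift (g : Elt) (n : ℤ) : Elt := ⟨g.k + n, g.w⟩

lemma Elt.shift_val (g : Elt) (n : ℤ) : (g.shift n).val = g.val * zU ^ n := by
  simp only [shift, val, zpow_add, mul_assoc]
  rw [((z_comm_rev g.w).zpow_left n).eq]

/-- The reflection `s` (for `true`) or `u` (for `false`). -/
def rVal : Bool → Hˣ
  | true => sU
  | false => uU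

/-- Right multiplication by `s^{±1}` or `u^{±1}`; the second Boolean is `true` for exponent `1`. -/
def Elt.mulR (g : Elt) : Bool → Bool → Elt
  | true, true => (g.mulWord [.e, .v, .e, .v]).shift 1
  | true, false => (g.mulWord [.u, .d, .u, .d]).shift (-1)
  | false, true => g.push .u
  | false, false => g.push .v

/-- `r` or `r⁻¹`. -/
def sgn (r : Hˣ) : Bool → Hˣ
  | true => r
  | false => r⁻¹

lemma word_comm (l : List Ltr) : Commute zU (wordVal l) := by
  induction l with
  | nil => exact Commute.one_right _
  | cons x l ih => exact x.comm.mul_right ih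

lemma Elt.mulR_val (g : Elt) (a b : Bool) : (g.mulR a b).val = g.val * sgn (rVal a) b := by
  cases a <;> cases b
  · exact push_val _ _
  · exact push_val _ _
  · simp only [mulR, shift_val, mulWord_val, sgn, rVal]
    rw [s_eq, mul_assoc, ← ((word_comm _).zpow_left _).eq]
    simp [wordVal, Ltr.val, mul_assoc]
    rw [← mul_assoc uU]
    have h := (word_comm [.u, .d, .u, .d]).inv_left.eq
    simpa [wordVal, Ltr.val, mul_assoc] using h
  · simp only [mulR, shift_val, mulWord_val, sgn, rVal]
    rw [s_eq, mul_assoc, ← ((word_comm _).zpow_left _).eq]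
    simp [wordVal, Ltr.val, mul_assoc]

/-- Right multiplication by the conjugate of `s^{±1}` or `u^{±1}` by a word. -/
def Elt.act (g : Elt) (x : List Ltr) (a b : Bool) : Elt :=
  ((g.mulWord x).mulR a b).mulInv x

lemma Elt.act_val (g : Elt) (x : List Ltr) (a b : Bool) :
    (g.act x a b).val = g.val * wordVal x * sgn (rVal a) b * (wordVal x)⁻¹ := by
  rw [act, mulInv_val, mulR_val, mulWord_val]

/-! ### Membership in the span -/

/-- The span of the family `B`. -/
def Sp : Submodule Rr H := Submodule.span Rr (Set.range B)

/-- The shift element `h = uδ`. -/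
def hU : Hˣ := uU * dU

/-- `g` is known: `g h⁻¹` lies in the span. -/
def Known (g : Elt) : Prop := ((g.val * hU⁻¹ : Hˣ) : H) ∈ Sp

lemma r_quad (a : Bool) : ∃ α β γ : Rr, β * γ = 1 ∧
    (rVal a : H) = α • (1 : H) + β • ((rVal a)⁻¹ : Hˣ) := by
  have key : ∀ (r : Hˣ) (α β : Rr), (r : H) * r = α • (r : H) + β • (1 : H) →
      (r : H) = α • (1 : H) + β • (r⁻¹ : Hˣ) := by
    intro r α β h
    have hh := congrArg (· * ((r⁻¹ : Hˣ) : H)) h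
    simpa [add_mul, mul_assoc] using hh
  cases a
  · exact ⟨pc, pd, pdInv, pd_inv, key uU pc pd u_sq⟩
  · exact ⟨pa, pb, pbInv, pb_inv, key sU pa pb s_sq⟩

lemma known_act (g : Elt) (x : List Ltr) (a b : Bool) (hg : Known g)
    (h : Known (g.act x a !b)) : Known (g.act x a b) := by
  obtain ⟨α, β, γ, hβ, hr⟩ := r_quad a
  have main : (((g.act x a true).val * hU⁻¹ : Hˣ) : H) =
      α • ((g.val * hU⁻¹ : Hˣ) : H) + β • (((g.act x a false).val * hU⁻¹ : Hˣ) : H) := by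
    rw [Elt.act_val, Elt.act_val]
    simp only [sgn]
    have e1 : ((g.val * hU⁻¹ : Hˣ) : H) =
        ((g.val * wordVal x : Hˣ) : H) * 1 * (((wordVal x)⁻¹ * hU⁻¹ : Hˣ) : H) := by
      rw [mul_one, ← Units.val_mul]; simp [mul_assoc]
    have e2 : ∀ r : Hˣ, ((g.val * wordVal x * r * (wordVal x)⁻¹ * hU⁻¹ : Hˣ) : H) =
        ((g.val * wordVal x : Hˣ) : H) * r * (((wordVal x)⁻¹ * hU⁻¹ : Hˣ) : H) := by
      intro r; simp only [Units.val_mul, mul_assoc]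
    rw [e1, e2, e2, hr]
    simp only [mul_add, add_mul, mul_smul_comm, smul_mul_assoc]
  unfold Known at *
  cases b
  · simp only [Bool.not_false] at h
    have : (((g.act x a false).val * hU⁻¹ : Hˣ) : H) =
        γ • ((((g.act x a true).val * hU⁻¹ : Hˣ) : H) + (-α) • ((g.val * hU⁻¹ : Hˣ) : H)) := by
      rw [main, add_right_comm, ← add_smul, add_neg_cancel, zero_smul, zero_add, smul_smul,
        mul_comm, hβ, one_smul]
    rw [this]
    exact Sp.smul_mem _ (Sp.add_mem h (Sp.smul_mem _ hg))
  · simp only [Bool.not_true] at h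
    rw [main]
    exact Sp.add_mem (Sp.smul_mem _ hg) (Sp.smul_mem _ h)

/-- Letters `s`, `t`, `u` as `0`, `1`, `2`. -/
def genVal : Fin 3 → Hˣ := ![sU, tU, uU]

/-- Right multiplication by a generator. -/
def Elt.mulGen (g : Elt) : Fin 3 → Elt
  | 0 => g.mulR true true
  | 1 => g.mulWord [.u, .d, .u, .e, .v]
  | 2 => g.push .u

lemma Elt.mulGen_val (g : Elt) (i : Fin 3) : (g.mulGen i).val = g.val * genVal i := by
  fin_cases i
  · exact mulR_val g true true
  · change (g.mulWord [.u, .d, .u, .e, .v]).val = g.val * tU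
    rw [mulWord_val, t_eq]
    simp [wordVal, Ltr.val, mul_assoc]
  · exact push_val g .u

/-- Right multiplication by a word in the generators. -/
def Elt.mulGens : Elt → List (Fin 3) → Elt
  | g, [] => g
  | g, i :: l => (g.mulGen i).mulGens l

/-- The product of a word in the generators. -/
def gensVal : List (Fin 3) → Hˣ
  | [] => 1
  | i :: l => genVal i * gensVal l

lemma Elt.mulGens_val (l : List (Fin 3)) : ∀ g : Elt,
    (g.mulGens l).val = g.val * gensVal l := by
  induction l with
  | nil => intro g; simp [mulGens, gensVal]
  | cons x l ih => intro g; rw [mulGens, ih, mulGen_val, gensVal, mul_assoc]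

/-- The words of the elements `E`. -/
def eWords : List (List (Fin 3)) :=
  [[], [2], [0], [1, 0], [0, 2], [2, 0], [1, 2], [1, 0, 2], [1, 2, 0], [0, 1, 0], [0, 1, 2],
    [2, 1, 0]]

/-- The word of `E m`. -/
def eWord (m : Fin 12) : List (Fin 3) := eWords.get (m.cast rfl)

lemma eWord_val (m : Fin 12) : (gensVal (eWord m) : H) = E m := by
  fin_cases m <;>
    simp [eWord, eWords, E, gensVal, genVal, val_s, val_t, val_u, mul_assoc]

/-- The element `z^k · g · E m · t^l · h`, with `g` a word in the generators. -/
def stdElt (k : ℕ) (g : List (Fin 3)) (m : Fin 12) (l : List (Fin 3)) : Elt :=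
  (((((⟨k, []⟩ : Elt).mulGens g).mulGens (eWord m)).mulGens l).push .u).push .d

lemma stdElt_val (k : ℕ) (g : List (Fin 3)) (m : Fin 12) (l : List (Fin 3)) :
    (((stdElt k g m l).val * hU⁻¹ : Hˣ) : H) = z ^ k * gensVal g * E m * gensVal l := by
  simp only [stdElt, Elt.push_val, Elt.mulGens_val, Ltr.val, hU]
  rw [← eWord_val, ← val_z]
  simp [Elt.val, revVal, mul_assoc]

lemma std_mem (k : Fin 4) (m : Fin 12) (l : Fin 2) : z ^ k.val * E m * t ^ l.val ∈ Sp := by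
  have h : B ⟨24 * k + 12 * l + m, by omega⟩ ∈ Sp := Submodule.subset_span ⟨_, rfl⟩
  have e1 : (24 * k.val + 12 * l + m) / 24 = k := by omega
  have e2 : (24 * k.val + 12 * l + m) % 12 = m := by omega
  have e3 : (24 * k.val + 12 * l + m) / 12 % 2 = l := by omega
  simpa only [B, e1, e2, e3] using h

section BaseData
open Ltr

def baseList : List Elt := [
  ⟨0,[.d,.u]⟩, ⟨0,[.d,.u,.u]⟩, ⟨1,[.v,.e]⟩, ⟨1,[.v,.e,.v,.e,.u,.d,.u]⟩,
  ⟨1,[.d,.u,.e,.v,.e]⟩, ⟨1,[.v,.e,.u]⟩, ⟨0,[.d,.u,.e,.u,.d,.u]⟩, ⟨1,[.d,.u,.e,.v,.e,.v,.e,.u,.d,.u]⟩,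
  ⟨0,[.v,.d,.u,.d,.u]⟩, ⟨1,[.v,.e,.v,.d]⟩, ⟨0,[.d,.u,.d]⟩, ⟨1,[.v,.e,.v,.e,.u,.d,.u,.u]⟩,
  ⟨1,[.d,.u]⟩, ⟨1,[.d,.u,.u]⟩, ⟨2,[.v,.e]⟩, ⟨2,[.v,.e,.v,.e,.u,.d,.u]⟩,
  ⟨2,[.d,.u,.e,.v,.e]⟩, ⟨2,[.v,.e,.u]⟩, ⟨1,[.d,.u,.e,.u,.d,.u]⟩, ⟨2,[.d,.u,.e,.v,.e,.v,.e,.u,.d,.u]⟩,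
  ⟨1,[.v,.d,.u,.d,.u]⟩, ⟨2,[.v,.e,.v,.d]⟩, ⟨1,[.d,.u,.d]⟩, ⟨2,[.v,.e,.v,.e,.u,.d,.u,.u]⟩,
  ⟨2,[.d,.u]⟩, ⟨2,[.d,.u,.u]⟩, ⟨3,[.v,.e]⟩, ⟨3,[.v,.e,.v,.e,.u,.d,.u]⟩,
  ⟨3,[.d,.u,.e,.v,.e]⟩, ⟨3,[.v,.e,.u]⟩, ⟨2,[.d,.u,.e,.u,.d,.u]⟩, ⟨3,[.d,.u,.e,.v,.e,.v,.e,.u,.d,.u]⟩,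
  ⟨2,[.v,.d,.u,.d,.u]⟩, ⟨3,[.v,.e,.v,.d]⟩, ⟨2,[.d,.u,.d]⟩, ⟨3,[.v,.e,.v,.e,.u,.d,.u,.u]⟩,
  ⟨3,[.d,.u]⟩, ⟨3,[.d,.u,.u]⟩, ⟨4,[.v,.e]⟩, ⟨4,[.v,.e,.v,.e,.u,.d,.u]⟩,
  ⟨4,[.d,.u,.e,.v,.e]⟩, ⟨4,[.v,.e,.u]⟩, ⟨3,[.d,.u,.e,.u,.d,.u]⟩, ⟨4,[.d,.u,.e,.v,.e,.v,.e,.u,.d,.u]⟩,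
  ⟨3,[.v,.d,.u,.d,.u]⟩, ⟨4,[.v,.e,.v,.d]⟩, ⟨3,[.d,.u,.d]⟩, ⟨4,[.v,.e,.v,.e,.u,.d,.u,.u]⟩,
  ⟨0,[.u,.d,.u]⟩, ⟨0,[.u,.d,.u,.u]⟩, ⟨1,[.e]⟩, ⟨1,[.e,.v,.e,.u,.d,.u]⟩,
  ⟨1,[.u,.d,.u,.e,.v,.e]⟩, ⟨1,[.e,.u]⟩, ⟨0,[.u,.d,.u,.e,.u,.d,.u]⟩, ⟨1,[.u,.d,.u,.e,.v,.e,.v,.e,.u,.d,.u]⟩,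
  ⟨0,[.d,.u,.d,.u]⟩, ⟨1,[.e,.v,.d]⟩, ⟨0,[.u,.d,.u,.d]⟩, ⟨1,[.e,.v,.e,.u,.d,.u,.u]⟩,
  ⟨1,[.u,.d,.u]⟩, ⟨1,[.u,.d,.u,.u]⟩, ⟨2,[.e]⟩, ⟨2,[.e,.v,.e,.u,.d,.u]⟩,
  ⟨2,[.u,.d,.u,.e,.v,.e]⟩, ⟨2,[.e,.u]⟩, ⟨1,[.u,.d,.u,.e,.u,.d,.u]⟩, ⟨2,[.u,.d,.u,.e,.v,.e,.v,.e,.u,.d,.u]⟩,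
  ⟨1,[.d,.u,.d,.u]⟩, ⟨2,[.e,.v,.d]⟩, ⟨1,[.u,.d,.u,.d]⟩, ⟨2,[.e,.v,.e,.u,.d,.u,.u]⟩,
  ⟨2,[.u,.d,.u]⟩, ⟨2,[.u,.d,.u,.u]⟩, ⟨3,[.e]⟩, ⟨3,[.e,.v,.e,.u,.d,.u]⟩,
  ⟨3,[.u,.d,.u,.e,.v,.e]⟩, ⟨3,[.e,.u]⟩, ⟨2,[.u,.d,.u,.e,.u,.d,.u]⟩, ⟨3,[.u,.d,.u,.e,.v,.e,.v,.e,.u,.d,.u]⟩,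
  ⟨2,[.d,.u,.d,.u]⟩, ⟨3,[.e,.v,.d]⟩, ⟨2,[.u,.d,.u,.d]⟩, ⟨3,[.e,.v,.e,.u,.d,.u,.u]⟩,
  ⟨3,[.u,.d,.u]⟩, ⟨3,[.u,.d,.u,.u]⟩, ⟨4,[.e]⟩, ⟨4,[.e,.v,.e,.u,.d,.u]⟩,
  ⟨4,[.u,.d,.u,.e,.v,.e]⟩, ⟨4,[.e,.u]⟩, ⟨3,[.u,.d,.u,.e,.u,.d,.u]⟩, ⟨4,[.u,.d,.u,.e,.v,.e,.v,.e,.u,.d,.u]⟩,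
  ⟨3,[.d,.u,.d,.u]⟩, ⟨4,[.e,.v,.d]⟩, ⟨3,[.u,.d,.u,.d]⟩, ⟨4,[.e,.v,.e,.u,.d,.u,.u]⟩]

end BaseData

/-- Checking that the listed elements agree with the family `z^k E_m t^l h`. -/
def checkBase : List Elt → List (Fin 2 × Fin 4 × Fin 12) → Bool
  | [], _ => true
  | _ :: _, [] => false
  | g :: L, (l, k, m) :: M =>
    (g.eqb (stdElt k [] m (List.replicate l 1))) && checkBase L M

lemma checkBase_sound : ∀ (L : List Elt) (M : List (Fin 2 × Fin 4 × Fin 12)),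
    checkBase L M = true → ∀ g ∈ L, Known g
  | [], _, _ => by simp
  | _ :: _, [], h => by cases h
  | g :: L, (l, k, m) :: M, h => by
    simp only [checkBase, Bool.and_eq_true] at h
    intro x hx
    rcases List.mem_cons.1 hx with rfl | hx
    · rw [Elt.eq_of_eqb h.1, Known, stdElt_val]
      have := std_mem k m l
      fin_cases l <;> simpa [gensVal, genVal, val_t] using this
    · exact checkBase_sound L M h.2 x hx

/-- All indices. -/
def baseIdx : List (Fin 2 × Fin 4 × Fin 12) :=
  (List.finRange 2).flatMap fun l => (List.finRange 4).flatMap fun k =>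
    (List.finRange 12).map fun m => (l, k, m)

/-- One step of the certificate: the new element `g` is obtained from the known elements number
`i` and `j`: it is the `i`-th one times `x a^{±1} x⁻¹`, while the `j`-th one is the `i`-th one
times `x a^{∓1} x⁻¹`. -/
structure Step : Type where
  /-- new element -/
  g : Elt
  /-- position of the middle element -/
  i : ℕ
  /-- position of the opposite element -/
  j : ℕ
  /-- conjugating word -/
  x : List Ltr
  /-- type of reflection -/
  a : Bool
  /-- sign -/
  b : Bool

/-- Run the certificate. -/
def run : List Elt → List Step → Option (List Elt)
  | K, [] => some K
  | K, ⟨g, i, j, x, a, b⟩ :: S =>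
    match K[i]?, K[j]? with
    | some p, some q =>
      match (p.act x a b).eqb g && (p.act x a !b).eqb q with
      | true => run (g :: K) S
      | false => none
    | _, _ => none

lemma run_sound : ∀ (S : List Step) (K K2 : List Elt), (∀ g ∈ K, Known g) →
    run K S = some K2 → ∀ g ∈ K2, Known g
  | [], K, K2, hK, h => by
    simp only [run, Option.some.injEq] at h
    exact h ▸ hK
  | ⟨g, i, j, x, a, b⟩ :: S, K, K2, hK, h => by
    rw [run] at h
    split at h
    · rename_i p q hp hq
      split at h
      · rename_i hc
        simp only [Bool.and_eq_true] at hc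
        refine run_sound S (g :: K) K2 ?_ h
        intro y hy
        rcases List.mem_cons.1 hy with rfl | hy
        · rw [← Elt.eq_of_eqb hc.1]
          refine known_act p x a b (hK _ (List.mem_of_getElem? hp)) ?_
          rw [Elt.eq_of_eqb hc.2]
          exact hK _ (List.mem_of_getElem? hq)
        · exact hK _ hy
      · cases h
    · cases h

section Certificate
open Ltr

def steps0 : List Step := [
  ⟨⟨3,[.d]⟩,59,58,[.e],false,false⟩, ⟨⟨2,[.d]⟩,72,71,[.e],false,false⟩,
  ⟨⟨1,[.d]⟩,85,84,[.e],false,false⟩, ⟨⟨2,[.e,.v]⟩,36,33,[.d],false,false⟩,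
  ⟨⟨2,[.d,.v,.d]⟩,25,65,[.e],false,false⟩, ⟨⟨4,[.e,.v]⟩,14,11,[.d],false,false⟩,
  ⟨⟨1,[.u,.d]⟩,41,40,[.v,.e],false,false⟩, ⟨⟨3,[.e,.v]⟩,28,25,[.d],false,false⟩,
  ⟨⟨4,[.e,.v,.e,.u,.d]⟩,16,8,[.d,.u,.d,.v,.e],false,false⟩, ⟨⟨3,[.d,.v,.d]⟩,18,58,[.e],false,false⟩,
  ⟨⟨2,[.u,.d]⟩,33,32,[.v,.e],false,false⟩, ⟨⟨3,[.d,.u,.d,.u,.e]⟩,20,61,[],true,false⟩,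
  ⟨⟨2,[.v,.v,.e]⟩,93,45,[],false,false⟩, ⟨⟨2,[.d,.v,.e,.v,.e]⟩,94,92,[.e],false,false⟩,
  ⟨⟨3,[.u,.d]⟩,25,24,[.v,.e],false,false⟩, ⟨⟨1,[.d,.v,.d]⟩,48,88,[.e],false,false⟩,
  ⟨⟨3,[.e,.v,.e,.u,.d]⟩,36,28,[.d,.u,.d,.v,.e],false,false⟩, ⟨⟨2,[.v,.d,.u,.d]⟩,78,30,[],false,false⟩,
  ⟨⟨2,[.d,.u,.d,.u,.e]⟩,39,80,[],true,false⟩, ⟨⟨2,[.d,.v]⟩,17,90,[.e],false,false⟩,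
  ⟨⟨1,[.d,.u,.d,.u,.e]⟩,53,94,[],true,false⟩, ⟨⟨3,[.v,.d,.u,.d]⟩,70,22,[],false,false⟩,
  ⟨⟨3,[.v,.d,.u]⟩,81,33,[],false,false⟩, ⟨⟨0,[.v,.d,.u,.d]⟩,108,60,[],false,false⟩,
  ⟨⟨4,[.v,.e,.v]⟩,81,78,[.u,.d],false,false⟩, ⟨⟨3,[.d,.v,.e,.v,.e]⟩,94,92,[.e],false,false⟩,
  ⟨⟨2,[.v,.d,.u]⟩,97,49,[],false,false⟩, ⟨⟨3,[.d,.v]⟩,26,86,[.e],false,false⟩,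
  ⟨⟨1,[.v,.d,.u,.d]⟩,101,53,[],false,false⟩, ⟨⟨3,[.d,.u,.d,.v,.e,.v,.e]⟩,90,94,[.e,.v,.e],true,true⟩,
  ⟨⟨1,[.e,.v,.e,.v,.d,.u]⟩,75,74,[.d,.u,.d],false,false⟩, ⟨⟨1,[.d,.v,.e,.u,.d,.u]⟩,66,108,[.e],false,false⟩,
  ⟨⟨2,[.v,.e,.v]⟩,113,110,[.u,.d],false,false⟩, ⟨⟨3,[.e,.u,.e,.u,.d,.u]⟩,48,53,[.d],false,true⟩,
  ⟨⟨2,[.d,.v,.d,.u]⟩,52,49,[.e],false,false⟩, ⟨⟨1,[.d,.v,.d,.u]⟩,65,62,[.e],false,false⟩,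
  ⟨⟨4,[.d,.u,.d,.v,.e,.v,.e]⟩,85,89,[.e,.v,.e],true,true⟩, ⟨⟨2,[.u,.d,.u,.d,.u]⟩,52,100,[],false,true⟩,
  ⟨⟨4,[.v,.v,.e]⟩,95,47,[],false,false⟩, ⟨⟨1,[.v,.d,.u]⟩,122,74,[],false,false⟩,
  ⟨⟨1,[.d,.u,.d,.v,.e,.v,.e]⟩,125,129,[.e,.v,.e],true,true⟩, ⟨⟨4,[.d,.v,.e,.v,.e]⟩,98,96,[.e],false,false⟩,
  ⟨⟨3,[.v,.e,.v]⟩,111,108,[.u,.d],false,false⟩, ⟨⟨3,[.v,.v,.e,.v,.d]⟩,105,57,[],false,false⟩,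
  ⟨⟨2,[.v,.e,.u,.u]⟩,122,125,[.u,.d],false,true⟩, ⟨⟨2,[.e,.v,.e,.u,.d]⟩,77,69,[.d,.u,.d,.v,.e],false,false⟩,
  ⟨⟨4,[.v,.e,.v,.e,.v,.e]⟩,115,117,[],true,true⟩, ⟨⟨1,[.u,.d,.u,.e,.u,.e]⟩,84,90,[.v,.e,.v,.d],false,true⟩,
  ⟨⟨2,[.e,.v,.e,.v,.d,.u]⟩,81,80,[.d,.u,.d],false,false⟩, ⟨⟨4,[.e,.v,.e,.v,.d,.u]⟩,58,57,[.d,.u,.d],false,false⟩,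
  ⟨⟨0,[.u,.d,.u,.d,.u]⟩,89,137,[],false,true⟩, ⟨⟨2,[.d,.u,.e,.v,.v,.e]⟩,130,124,[.e,.v,.d],false,false⟩,
  ⟨⟨3,[.e,.v,.e,.v,.d,.u]⟩,73,72,[.d,.u,.d],false,false⟩, ⟨⟨2,[.v,.e,.v,.e,.v,.e]⟩,146,148,[],true,true⟩,
  ⟨⟨3,[.v,.e,.u,.u]⟩,120,123,[.u,.d],false,true⟩, ⟨⟨3,[.v,.d,.u,.e,.v,.e]⟩,122,74,[],false,false⟩,
  ⟨⟨1,[.d,.v]⟩,53,139,[.e],false,false⟩, ⟨⟨1,[.u,.d,.u,.d,.u]⟩,84,132,[],false,true⟩,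
  ⟨⟨2,[.d,.u,.d,.u,.d,.u]⟩,117,115,[],true,false⟩, ⟨⟨1,[.d,.u,.u,.d,.u]⟩,86,89,[.e],false,true⟩]

def steps1 : List Step := [
  ⟨⟨2,[.d,.u,.u,.d,.u]⟩,75,78,[.e],false,true⟩, ⟨⟨1,[.v,.e,.u,.u]⟩,151,154,[.u,.d],false,true⟩,
  ⟨⟨2,[.d,.u,.d,.v,.e,.v,.e]⟩,135,139,[.e,.v,.e],true,true⟩, ⟨⟨4,[.v,.e,.u,.u]⟩,117,120,[.u,.d],false,true⟩,
  ⟨⟨1,[.d,.u,.d,.u,.d,.u]⟩,135,133,[],true,false⟩, ⟨⟨2,[.v,.e,.v,.e,.u,.d]⟩,145,137,[.u,.d,.u,.d,.v,.e],false,false⟩,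
  ⟨⟨4,[.v,.e,.v,.e,.u,.d]⟩,122,114,[.u,.d,.u,.d,.v,.e],false,false⟩, ⟨⟨3,[.d,.v,.e,.u,.d,.u]⟩,78,120,[.e],false,false⟩,
  ⟨⟨4,[.v,.d,.u,.e,.v,.e]⟩,123,75,[],false,false⟩, ⟨⟨2,[.d,.u,.d,.u,.u]⟩,84,130,[.e,.v,.e],false,true⟩,
  ⟨⟨2,[.v,.d,.u,.u,.d,.u]⟩,133,136,[.u,.e],false,true⟩, ⟨⟨5,[.d,.u,.e,.v,.e,.v,.e,.v,.e]⟩,126,129,[.e,.v,.v],true,true⟩,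
  ⟨⟨3,[.v,.d,.u,.e,.u,.d,.u]⟩,125,77,[],false,false⟩, ⟨⟨3,[.v,.e,.v,.e,.v,.e]⟩,154,156,[],true,true⟩,
  ⟨⟨2,[.v,.d,.u,.e,.u,.d,.u]⟩,139,91,[],false,false⟩, ⟨⟨3,[.u,.d,.v,.e,.v,.e]⟩,96,94,[.v,.e],false,false⟩,
  ⟨⟨3,[.v,.e,.v,.e,.u,.d]⟩,144,136,[.u,.d,.u,.d,.v,.e],false,false⟩, ⟨⟨1,[.d,.u,.e,.u,.u,.d,.u]⟩,154,159,[.e,.v,.d],false,true⟩,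
  ⟨⟨0,[.d,.u,.d,.u,.u]⟩,117,163,[.e,.v,.e],false,true⟩, ⟨⟨1,[.u,.d,.u,.d,.v,.e,.v,.e]⟩,116,120,[.v,.e,.v,.e],true,true⟩,
  ⟨⟨4,[.v,.v,.e,.v,.d]⟩,130,82,[],false,false⟩, ⟨⟨3,[.d,.u,.e,.v,.e,.v,.e,.v,.e]⟩,160,163,[.e,.v,.v],true,true⟩,
  ⟨⟨5,[.v,.e,.v,.e,.v,.e]⟩,139,141,[],true,true⟩, ⟨⟨0,[.d,.u,.u,.d,.u]⟩,122,125,[.e],false,true⟩,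
  ⟨⟨2,[.v,.e,.v,.d,.v,.e,.v,.e]⟩,170,176,[.u,.d,.u,.e],true,true⟩, ⟨⟨2,[.d,.v,.e,.u,.d,.u]⟩,108,150,[.e],false,false⟩,
  ⟨⟨1,[.d,.u,.d,.u,.u]⟩,113,159,[.e,.v,.e],false,true⟩, ⟨⟨2,[.v,.d,.u,.e,.v,.e]⟩,166,118,[],false,false⟩,
  ⟨⟨2,[.v,.e,.v,.e,.v,.d,.u]⟩,169,168,[.u,.d,.u,.d],false,false⟩, ⟨⟨0,[.d,.u,.e,.u,.u,.d,.u]⟩,178,183,[.e,.v,.d],false,true⟩,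
  ⟨⟨4,[.v,.e,.v,.e,.v,.d,.u]⟩,147,146,[.u,.d,.u,.d],false,false⟩, ⟨⟨0,[.d,.u,.d,.u,.d,.u]⟩,174,172,[],true,false⟩,
  ⟨⟨1,[.v,.d,.u,.e,.u,.d,.u]⟩,169,121,[],false,false⟩, ⟨⟨1,[.d,.u,.d,.u,.u,.d,.u]⟩,116,161,[],true,false⟩,
  ⟨⟨0,[.v,.d,.u,.e,.u,.d,.u]⟩,183,135,[],false,false⟩, ⟨⟨3,[.v,.d,.u,.u,.d,.u]⟩,146,149,[.u,.e],false,true⟩,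
  ⟨⟨5,[.v,.e,.v,.d,.v,.e,.v,.e]⟩,146,152,[.u,.d,.u,.e],true,true⟩, ⟨⟨3,[.v,.e,.v,.d,.v,.e,.v,.e]⟩,171,177,[.u,.d,.u,.e],true,true⟩,
  ⟨⟨2,[.d,.u,.e,.u,.u,.d,.u]⟩,163,168,[.e,.v,.d],false,true⟩, ⟨⟨1,[.v,.d,.u,.u,.d,.u]⟩,174,177,[.u,.e],false,true⟩,
  ⟨⟨3,[.d,.u,.e,.u,.u,.d,.u]⟩,153,158,[.e,.v,.d],false,true⟩, ⟨⟨4,[.v,.e,.v,.d,.v,.e,.v,.e]⟩,163,169,[.u,.d,.u,.e],true,true⟩,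
  ⟨⟨3,[.v,.e,.v,.e,.v,.d,.u]⟩,171,170,[.u,.d,.u,.d],false,false⟩, ⟨⟨1,[.u,.d,.u,.u,.d,.u,.d,.u]⟩,125,122,[.v,.e,.v,.v],true,false⟩,
  ⟨⟨0,[.v,.d,.u,.u,.d,.u]⟩,191,194,[.u,.e],false,true⟩, ⟨⟨4,[.d,.u,.e,.v,.e,.v,.e,.v,.e]⟩,172,175,[.e,.v,.v],true,true⟩,
  ⟨⟨2,[.e,.v,.e,.v,.d,.u,.d,.u]⟩,133,135,[.v],true,true⟩, ⟨⟨2,[.d,.u,.e,.v,.e,.v,.e,.v,.e]⟩,198,201,[.e,.v,.v],true,true⟩,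
  ⟨⟨-1,[.u,.d,.u,.u,.d,.u,.d,.u]⟩,154,151,[.v,.e,.v,.v],true,false⟩, ⟨⟨2,[.v,.e,.v,.e,.u,.u,.d,.u]⟩,189,190,[.u,.d,.u,.d],false,true⟩,
  ⟨⟨2,[.d,.v,.e,.v,.e,.v,.e,.u,.d,.u]⟩,190,186,[.e],false,false⟩, ⟨⟨1,[.v,.e,.v,.e,.u,.u,.d,.u]⟩,203,204,[.u,.d,.u,.d],false,true⟩,
  ⟨⟨0,[.u,.d,.u,.u,.d,.u,.d,.u]⟩,146,143,[.v,.e,.v,.v],true,false⟩, ⟨⟨2,[.v,.d]⟩,111,102,[],false,false⟩,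
  ⟨⟨4,[.d,.v,.e,.v,.e,.v,.e,.u,.d,.u]⟩,170,166,[.e],false,false⟩, ⟨⟨1,[.d,.u,.e,.v,.e,.v,.e,.u,.u,.d,.u]⟩,203,206,[.e,.v,.d,.u,.d,.u,.d],false,true⟩,
  ⟨⟨4,[.v,.e,.v,.e,.u,.u,.d,.u]⟩,172,173,[.u,.d,.u,.d],false,true⟩, ⟨⟨3,[.v,.e,.v,.e,.u,.u,.d,.u]⟩,185,186,[.u,.d,.u,.d],false,true⟩,
  ⟨⟨3,[.d,.v,.e,.v,.e,.v,.e,.u,.d,.u]⟩,186,182,[.e],false,false⟩, ⟨⟨3,[.v,.d]⟩,118,104,[],false,false⟩]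

def steps2 : List Step := [
  ⟨⟨2,[.u,.d,.u,.u,.d,.u,.u,.d,.u]⟩,125,124,[.v,.e,.v,.v],true,false⟩, ⟨⟨4,[.v,.e,.v,.v,.e,.u,.d,.u]⟩,177,172,[.u,.d],false,false⟩,
  ⟨⟨2,[.u,.d,.u,.u,.d,.u,.d,.u]⟩,132,129,[.v,.e,.v,.v],true,false⟩, ⟨⟨3,[.d,.u,.e,.v,.e,.v,.e,.u,.u,.d,.u]⟩,187,190,[.e,.v,.d,.u,.d,.u,.d],false,true⟩,
  ⟨⟨3,[.d,.u,.d,.v,.e]⟩,183,112,[.e,.v,.e],false,false⟩, ⟨⟨4,[.d,.u,.e,.v,.e,.v,.e,.u,.u,.d,.u]⟩,177,180,[.e,.v,.d,.u,.d,.u,.d],false,true⟩,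
  ⟨⟨2,[.d,.u,.e,.v,.e,.v,.e,.u,.u,.d,.u]⟩,202,205,[.e,.v,.d,.u,.d,.u,.d],false,true⟩, ⟨⟨1,[.u,.d,.u,.u,.d,.u,.u,.d,.u]⟩,144,143,[.v,.e,.v,.v],true,false⟩,
  ⟨⟨1,[.v,.d]⟩,125,121,[],false,false⟩, ⟨⟨2,[.v,.d,.v,.d]⟩,198,111,[.u,.e],false,false⟩,
  ⟨⟨-1,[.u,.d,.u,.u,.d,.u,.u,.d,.u]⟩,171,170,[.v,.e,.v,.v],true,false⟩, ⟨⟨0,[.u,.d,.u,.u,.d,.u,.u,.d,.u]⟩,160,159,[.v,.e,.v,.v],true,false⟩,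
  ⟨⟨1,[.d,.u,.d,.v,.e]⟩,215,111,[.e,.v,.e],false,false⟩, ⟨⟨2,[.d,.u,.d,.v,.e]⟩,204,114,[.e,.v,.e],false,false⟩,
  ⟨⟨3,[.v,.d,.v,.d]⟩,191,112,[.u,.e],false,false⟩, ⟨⟨2,[.d,.u,.d,.u,.d]⟩,134,110,[],true,false⟩,
  ⟨⟨3,[.e,.u,.d,.u]⟩,135,94,[.e],true,false⟩, ⟨⟨2,[.v,.d,.u,.d,.u,.u]⟩,200,119,[.u,.e,.v,.e],false,true⟩,
  ⟨⟨1,[.e,.u,.d,.u]⟩,135,124,[.e],true,false⟩, ⟨⟨0,[.v,.d,.u,.d,.u,.u]⟩,226,115,[.u,.e,.v,.e],false,true⟩,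
  ⟨⟨0,[.d,.u,.d,.u,.d]⟩,137,107,[],true,false⟩, ⟨⟨2,[.e,.u,.d,.u]⟩,139,115,[.e],true,false⟩,
  ⟨⟨0,[.u,.d,.u,.e,.u]⟩,237,111,[.v],true,false⟩, ⟨⟨1,[.v,.d,.u,.d,.u,.u]⟩,218,114,[.u,.e,.v,.e],false,true⟩,
  ⟨⟨3,[.v,.d,.u,.d,.u,.u]⟩,195,122,[.u,.e,.v,.e],false,true⟩, ⟨⟨4,[.e,.v,.e,.v,.d]⟩,139,136,[.d,.u,.d],false,false⟩,
  ⟨⟨2,[.v,.d,.u,.d,.u,.e]⟩,215,102,[.u],true,false⟩, ⟨⟨3,[.u,.d,.u,.e,.u]⟩,206,97,[.v],true,false⟩,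
  ⟨⟨3,[.e,.v,.e,.v,.d]⟩,140,131,[.d,.u,.d],false,false⟩, ⟨⟨1,[.u,.d,.u,.e,.u]⟩,232,100,[.v],true,false⟩,
  ⟨⟨2,[.u,.d,.u,.e,.u]⟩,221,97,[.v],true,false⟩, ⟨⟨0,[.u,.u,.d,.u,.d,.u]⟩,100,190,[],false,true⟩,
  ⟨⟨2,[.e,.v,.e,.v,.d]⟩,148,106,[.d,.u,.d],false,false⟩, ⟨⟨1,[.u,.d,.u,.d,.u,.u]⟩,95,178,[.v,.e,.v,.e],false,true⟩,
  ⟨⟨0,[.u,.d,.u,.d,.u,.u]⟩,103,191,[.v,.e,.v,.e],false,true⟩, ⟨⟨2,[.e,.u,.e,.u,.d,.u,.u]⟩,68,179,[.d],false,true⟩,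
  ⟨⟨3,[.v,.d,.u,.d,.u,.e]⟩,213,75,[.u],true,false⟩, ⟨⟨1,[.e,.u,.e,.u,.d,.u,.u]⟩,78,193,[.d],false,true⟩,
  ⟨⟨3,[.v,.d,.v,.e,.u,.d,.u]⟩,217,85,[.u,.e],false,false⟩, ⟨⟨2,[.v,.d,.v,.e,.u,.d,.u]⟩,230,84,[.u,.e],false,false⟩,
  ⟨⟨2,[.d,.u,.d,.u,.u,.d]⟩,145,93,[],true,false⟩, ⟨⟨3,[.u,.d,.u,.e]⟩,160,15,[.v],true,false⟩,
  ⟨⟨3,[.v,.d,.v,.e,.v,.e]⟩,136,86,[],false,false⟩, ⟨⟨3,[.d,.u,.e,.u]⟩,140,72,[],true,false⟩,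
  ⟨⟨4,[.v,.e,.v,.e,.v,.d]⟩,139,97,[.u,.d,.u,.d],false,false⟩, ⟨⟨4,[.v,.d,.v,.e,.v,.e]⟩,126,96,[.u,.e],false,false⟩,
  ⟨⟨2,[.v,.e,.v,.e,.v,.d]⟩,133,100,[.u,.d,.u,.d],false,false⟩, ⟨⟨2,[.v,.d,.v,.e,.v,.e]⟩,154,79,[.u,.e],false,false⟩,
  ⟨⟨1,[.d,.u,.e,.u]⟩,128,79,[],true,false⟩, ⟨⟨2,[.u,.d,.u,.e]⟩,167,20,[.v],true,false⟩,
  ⟨⟨3,[.v,.d,.u,.d,.v,.e,.v,.e]⟩,152,95,[.u,.e,.v,.e],true,true⟩, ⟨⟨3,[.v,.e,.v,.e,.v,.d]⟩,128,94,[.u,.d,.u,.d],false,false⟩,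
  ⟨⟨2,[.d,.u,.e,.u]⟩,145,69,[],true,false⟩, ⟨⟨1,[.u,.d,.u,.e]⟩,170,20,[.v],true,false⟩,
  ⟨⟨3,[.d,.u,.d,.u,.e,.v,.e,.v,.e]⟩,155,80,[.e,.v,.e,.v,.v],true,true⟩, ⟨⟨1,[.v,.d,.u,.d,.v,.e,.v,.e]⟩,151,80,[.u,.e,.v,.e],true,true⟩,
  ⟨⟨4,[.e,.v,.e,.v,.v,.d]⟩,30,170,[.d,.u,.d],false,false⟩, ⟨⟨1,[.e,.u,.u,.d,.u]⟩,145,66,[.e],true,false⟩,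
  ⟨⟨2,[.e,.u,.u,.d,.u]⟩,92,59,[.e],true,false⟩, ⟨⟨2,[.v,.d,.u,.d,.v,.e]⟩,152,32,[.u,.e,.v,.e],false,false⟩]

def steps3 : List Step := [
  ⟨⟨3,[.e,.u,.u,.d,.u]⟩,112,65,[.e],true,false⟩, ⟨⟨3,[.v,.d,.u,.d,.v,.e]⟩,158,24,[.u,.e,.v,.e],false,false⟩,
  ⟨⟨2,[.d,.u,.d,.u,.d,.v,.e,.u,.d,.u]⟩,114,60,[],true,false⟩, ⟨⟨3,[.d,.u,.d,.v,.e,.v,.e,.v,.e]⟩,252,8,[.e,.v,.e],false,false⟩,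
  ⟨⟨2,[.u,.d,.u,.u,.e,.u]⟩,80,56,[.v,.e,.v,.v,.e],false,false⟩, ⟨⟨3,[.d,.u,.e]⟩,65,20,[],true,false⟩,
  ⟨⟨3,[.v,.d,.v,.e,.v,.d,.u]⟩,66,27,[.u,.e,.u,.d],false,false⟩, ⟨⟨3,[.u,.d,.u,.u,.e,.u]⟩,64,66,[.v,.e,.v,.v,.e],false,false⟩,
  ⟨⟨0,[.u,.d,.u,.u,.e,.u]⟩,79,57,[.v,.e,.v,.v,.e],false,false⟩, ⟨⟨2,[.d,.u,.d,.v,.d,.u]⟩,25,130,[.e,.v,.e],false,false⟩,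
  ⟨⟨2,[.v,.d,.v,.e,.v,.d,.u]⟩,76,30,[.u,.e,.u,.d],false,false⟩, ⟨⟨1,[.u,.d,.u,.u,.e,.u]⟩,78,59,[.v,.e,.v,.v,.e],false,false⟩,
  ⟨⟨2,[.v,.e,.u,.d,.u]⟩,78,29,[.u,.e],true,false⟩, ⟨⟨2,[.d,.u,.e]⟩,79,21,[],true,false⟩,
  ⟨⟨1,[.d,.u,.e]⟩,65,27,[],true,false⟩, ⟨⟨0,[.d,.u,.d,.v,.d,.u]⟩,26,103,[.e,.v,.e],false,false⟩,
  ⟨⟨1,[.d,.u,.d,.v,.d,.u]⟩,23,131,[.e,.v,.e],false,false⟩, ⟨⟨3,[.v,.e,.u,.d,.u]⟩,77,31,[.u,.e],true,false⟩,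
  ⟨⟨1,[.v,.e,.u,.d,.u]⟩,69,30,[.u,.e],true,false⟩, ⟨⟨3,[.e,.u,.d,.v,.e,.v,.e,.u]⟩,57,43,[.d,.v,.e],true,true⟩,
  ⟨⟨3,[.v,.d,.v,.e,.v,.v,.e]⟩,37,70,[.u,.e,.u,.d],false,false⟩, ⟨⟨2,[.e,.u,.d,.v,.e,.v,.e,.u]⟩,62,43,[.d,.v,.e],true,true⟩,
  ⟨⟨0,[.d,.u,.e,.u,.d,.u,.d,.u]⟩,33,69,[.e,.v,.e],true,false⟩, ⟨⟨2,[.u,.d,.u,.d,.v,.d]⟩,83,26,[.v],true,false⟩,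
  ⟨⟨3,[.v,.d,.u,.e,.u]⟩,40,56,[],false,false⟩, ⟨⟨4,[.v,.d,.v,.e,.v,.v,.e]⟩,39,70,[.u,.e,.u,.d],false,false⟩,
  ⟨⟨1,[.u]⟩,67,28,[.d],false,false⟩, ⟨⟨2,[.v,.d,.u,.e,.u]⟩,34,56,[],false,false⟩,
  ⟨⟨2,[.u]⟩,66,29,[.d],false,false⟩, ⟨⟨3,[.u]⟩,72,28,[.d],false,false⟩,
  ⟨⟨3,[.e,.u,.d,.u,.e,.v,.e,.u]⟩,281,10,[.d,.v,.e],false,true⟩, ⟨⟨2,[.e,.v,.e,.v,.d,.u,.e]⟩,16,163,[.v],true,true⟩,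
  ⟨⟨2,[.e,.u,.d,.u,.e,.v,.e,.u]⟩,295,10,[.d,.v,.e],false,true⟩, ⟨⟨3,[.d,.u,.e,.v,.e,.v,.e]⟩,19,153,[.e,.v,.v],true,true⟩,
  ⟨⟨2,[.d,.u,.e,.v,.e,.v,.e]⟩,19,130,[.e,.v,.v],true,true⟩, ⟨⟨2,[.d,.u,.d,.v,.d]⟩,29,79,[.e,.v,.e],false,false⟩,
  ⟨⟨2,[.d,.u,.d,.u,.d,.v,.e,.v,.d,.u]⟩,80,33,[.e,.v,.e,.v,.e,.u,.d],false,false⟩, ⟨⟨2,[.e,.v,.e]⟩,10,166,[.v],true,true⟩,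
  ⟨⟨3,[.e,.v,.e]⟩,9,160,[.v],true,true⟩, ⟨⟨4,[.e,.v,.e]⟩,9,181,[.v],true,true⟩,
  ⟨⟨0,[.u,.u]⟩,77,31,[.v,.e],false,false⟩, ⟨⟨2,[.u,.u]⟩,70,36,[.v,.e],false,false⟩,
  ⟨⟨2,[.e,.v,.e,.u,.d,.u,.e]⟩,219,10,[.d,.u,.d],false,true⟩, ⟨⟨3,[.u,.u]⟩,75,35,[.v,.e],false,false⟩,
  ⟨⟨0,[.d,.u,.e,.v,.d,.u,.d,.u]⟩,140,21,[.e,.v,.d],false,false⟩, ⟨⟨2,[.v,.e,.v,.e,.u]⟩,18,146,[],true,true⟩,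
  ⟨⟨1,[.u,.u]⟩,76,34,[.v,.e],false,false⟩, ⟨⟨3,[.d,.v,.e,.v,.d,.v,.e,.u]⟩,293,16,[.e],true,true⟩,
  ⟨⟨3,[.v,.d,.u,.e]⟩,42,66,[],false,false⟩, ⟨⟨2,[.d,.v,.e,.v,.d,.v,.e,.u]⟩,307,16,[.e],true,true⟩,
  ⟨⟨1,[.u,.d,.u,.d,.u,.e,.v,.e]⟩,23,150,[.v,.e,.v,.e],false,true⟩, ⟨⟨3,[.v,.e,.v,.e,.u]⟩,22,144,[],true,true⟩,
  ⟨⟨2,[.e,.u,.e]⟩,229,14,[.d],false,true⟩, ⟨⟨4,[.e,.u,.e]⟩,232,13,[.d],false,true⟩,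
  ⟨⟨3,[.e,.u,.e]⟩,232,15,[.d],false,true⟩, ⟨⟨1,[.d,.u,.e,.v]⟩,40,66,[.e,.v,.d],false,false⟩,
  ⟨⟨2,[.e,.v,.e,.u,.d,.u,.d,.u]⟩,27,129,[.d,.u,.d],false,true⟩, ⟨⟨1,[.v,.d,.u,.e]⟩,42,63,[],false,false⟩,
  ⟨⟨2,[.d,.u,.e,.u,.e,.v,.e]⟩,105,23,[.e,.v,.d],false,true⟩, ⟨⟨2,[.e,.v,.d,.v,.e,.v,.d]⟩,235,16,[.d,.u,.e],true,true⟩]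

def steps4 : List Step := [
  ⟨⟨3,[.d,.u,.e,.u,.e,.v,.e]⟩,106,26,[.e,.v,.d],false,true⟩, ⟨⟨1,[.d,.u,.e,.v,.e,.u,.e,.u,.d,.u]⟩,16,329,[.e,.v,.d,.u,.d],false,true⟩,
  ⟨⟨2,[.d,.v,.e,.v,.e,.v,.d]⟩,226,9,[.e],true,true⟩, ⟨⟨2,[.u,.d,.v,.e]⟩,34,73,[.v,.e],false,false⟩,
  ⟨⟨4,[.d,.v,.e,.v,.e,.v,.d]⟩,234,10,[.e],true,true⟩, ⟨⟨3,[.d,.v,.e,.v,.e,.v,.d]⟩,240,10,[.e],true,true⟩,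
  ⟨⟨2,[.d,.u,.d,.u,.e,.u,.d,.u,.e,.u]⟩,176,29,[.e,.v,.e,.v,.e],true,false⟩, ⟨⟨2,[.e,.u,.d,.v,.e,.v,.d]⟩,321,7,[.d],false,true⟩,
  ⟨⟨2,[.d,.u,.e,.v,.e,.v,.d]⟩,322,5,[.e],false,true⟩, ⟨⟨4,[.d,.u,.e,.v,.e,.v,.d]⟩,299,4,[.e],false,true⟩,
  ⟨⟨3,[.e,.v,.e,.u]⟩,28,96,[.v],true,true⟩, ⟨⟨3,[.d,.u,.e,.v,.e,.v,.d]⟩,313,5,[.e],false,true⟩,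
  ⟨⟨2,[.u,.e,.v,.e]⟩,25,100,[.v,.v],true,true⟩, ⟨⟨2,[.v,.d,.u,.e,.u,.d,.u,.d,.u]⟩,48,71,[.u,.e,.v,.e],true,false⟩,
  ⟨⟨2,[.e,.v,.e,.u]⟩,27,99,[.v],true,true⟩, ⟨⟨1,[.v,.d,.u,.e,.u,.d,.u,.d,.u]⟩,47,75,[.u,.e,.v,.e],true,false⟩,
  ⟨⟨3,[.e,.u,.e,.u]⟩,327,5,[.d],false,true⟩, ⟨⟨4,[.v,.e,.v,.e,.v,.d,.u,.e,.v,.e]⟩,201,16,[],true,true⟩,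
  ⟨⟨3,[.v,.e,.v,.e,.v,.d,.u,.e,.v,.e]⟩,170,19,[],true,true⟩, ⟨⟨2,[.e,.u,.e,.u]⟩,342,4,[.d],false,true⟩,
  ⟨⟨1,[.v,.d,.v,.e,.v,.d,.u,.d,.u,.d,.u]⟩,69,59,[.u,.e,.u,.d,.u],true,false⟩, ⟨⟨2,[.v,.d,.v,.e,.v,.d,.u,.d,.u,.d,.u]⟩,74,55,[.u,.e,.u,.d,.u],true,false⟩,
  ⟨⟨2,[.v,.d,.v,.e,.u,.d,.u,.d,.u]⟩,277,8,[.u,.e],false,false⟩, ⟨⟨1,[.v,.d,.v,.e,.u,.d,.u,.d,.u]⟩,290,7,[.u,.e],false,false⟩,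
  ⟨⟨2,[.v,.d,.u,.d,.v,.d]⟩,48,60,[],false,false⟩, ⟨⟨3,[.d,.v,.e,.v,.e,.v,.d,.u]⟩,230,8,[.e],true,true⟩,
  ⟨⟨2,[.d,.v,.e,.v,.e,.v,.d,.u]⟩,230,6,[.e],true,true⟩, ⟨⟨1,[.v,.e,.u,.d,.u,.e,.u,.d,.u,.d,.u]⟩,294,6,[.u,.e],true,false⟩,
  ⟨⟨2,[.v,.e,.u,.d,.u,.e,.u,.d,.u,.d,.u]⟩,283,6,[.u,.e],true,false⟩, ⟨⟨1,[]⟩,62,42,[],false,false⟩,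
  ⟨⟨2,[]⟩,61,48,[],false,false⟩, ⟨⟨2,[.v,.d,.v,.e,.v,.d,.u,.d,.u]⟩,337,8,[.u,.e,.u,.d],false,false⟩,
  ⟨⟨3,[]⟩,62,48,[],false,false⟩, ⟨⟨1,[.v,.d,.v,.e,.v,.d,.u,.d,.u]⟩,351,9,[.u,.e,.u,.d],false,false⟩,
  ⟨⟨1,[.e,.u,.d]⟩,4,312,[.d],false,true⟩, ⟨⟨2,[.e,.u,.d]⟩,4,301,[.d],false,true⟩,
  ⟨⟨3,[.e,.u,.d]⟩,3,290,[.d],false,true⟩, ⟨⟨3,[.v,.e,.v,.e]⟩,6,304,[],true,true⟩,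
  ⟨⟨0,[.d,.u,.u,.u]⟩,372,373,[.e],false,true⟩, ⟨⟨3,[.d,.u,.u,.u]⟩,337,338,[.e],false,true⟩,
  ⟨⟨4,[.v,.e,.v,.e,.u,.d,.u,.u,.u]⟩,328,336,[.u,.d,.u,.d,.v,.e],false,true⟩, ⟨⟨3,[.v,.e,.v,.e,.u,.d,.u,.u,.u]⟩,341,349,[.u,.d,.u,.d,.v,.e],false,true⟩,
  ⟨⟨1,[.v,.e,.v,.e,.u,.d,.u,.u,.u]⟩,366,374,[.u,.d,.u,.d,.v,.e],false,true⟩, ⟨⟨1,[.d,.u,.u,.u]⟩,365,366,[.e],false,true⟩,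
  ⟨⟨2,[.d,.u,.u,.u]⟩,354,355,[.e],false,true⟩, ⟨⟨2,[.v,.e,.v,.e,.u,.d,.u,.u,.u]⟩,357,365,[.u,.d,.u,.d,.v,.e],false,true⟩,
  ⟨⟨3,[.d,.v,.e,.v,.e,.v]⟩,266,10,[.e],true,true⟩, ⟨⟨2,[.v,.e,.u,.d,.u,.e,.u,.d,.u]⟩,358,15,[.u,.e],true,false⟩,
  ⟨⟨2,[.d,.v,.e,.v,.e,.v]⟩,231,13,[.e],true,true⟩, ⟨⟨1,[.v,.e,.u,.d,.u,.e,.u,.d,.u]⟩,372,15,[.u,.e],true,false⟩,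
  ⟨⟨4,[.d,.v,.e,.v,.e,.v]⟩,262,13,[.e],true,true⟩, ⟨⟨1,[.e,.u,.d,.u,.u]⟩,152,16,[.d,.v,.e],false,true⟩,
  ⟨⟨3,[.e,.u,.d,.u,.u]⟩,155,15,[.d,.v,.e],false,true⟩, ⟨⟨2,[.e,.u,.d,.u,.u]⟩,151,17,[.d,.v,.e],false,true⟩,
  ⟨⟨3,[.v,.d,.u,.d,.v,.e,.v,.v,.e]⟩,123,29,[.u,.e,.v,.e,.u,.d],false,false⟩, ⟨⟨3,[.d,.v,.e,.v,.e,.u]⟩,269,8,[.e,.u,.d,.u,.d],false,true⟩,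
  ⟨⟨2,[.d,.u,.e,.v,.e,.v]⟩,263,7,[.e],false,true⟩, ⟨⟨4,[.d,.u,.e,.v,.e,.v]⟩,272,6,[.e],false,true⟩,
  ⟨⟨2,[.d,.u,.e,.v,.e,.u]⟩,377,1,[.e,.v,.d,.u,.d],false,true⟩, ⟨⟨3,[.d,.u,.e,.v,.e,.u]⟩,365,3,[.e],false,true⟩]

def steps5 : List Step := [
  ⟨⟨4,[.d,.u,.e,.v,.e,.u]⟩,355,2,[.e,.v,.d,.u,.d],false,true⟩, ⟨⟨3,[.d,.v,.e]⟩,28,115,[.e],false,false⟩,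
  ⟨⟨2,[.d,.v,.e]⟩,31,108,[.e],false,false⟩, ⟨⟨2,[.v,.e,.v,.d,.u,.e,.u,.d,.u]⟩,161,15,[.u,.d],false,false⟩,
  ⟨⟨1,[.v,.e,.v,.d,.u,.e,.u,.d,.u]⟩,165,14,[.u,.d],false,false⟩, ⟨⟨2,[.v,.e,.v,.d,.u]⟩,34,112,[.u,.d],false,false⟩,
  ⟨⟨3,[.d,.u,.e,.u,.e,.u]⟩,321,6,[.e,.v,.d],false,true⟩, ⟨⟨2,[.d,.u,.e,.u,.e,.u]⟩,334,8,[.e,.v,.d],false,true⟩,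
  ⟨⟨2,[.e,.u,.d,.u,.d,.u]⟩,326,6,[.e],true,false⟩, ⟨⟨1,[.e,.u,.d,.u,.d,.u]⟩,339,6,[.e],true,false⟩,
  ⟨⟨2,[.v,.e,.u,.d,.u,.e,.u]⟩,39,119,[.u,.e],true,false⟩, ⟨⟨3,[.v,.e,.u,.d,.u,.e,.u]⟩,38,124,[.u,.e],true,false⟩,
  ⟨⟨2,[.e,.v,.d,.v,.e]⟩,59,81,[.v],true,true⟩, ⟨⟨3,[.v,.e,.v,.d,.u]⟩,40,115,[.u,.d],false,false⟩,
  ⟨⟨1,[.v,.e,.v,.d,.u]⟩,44,115,[.u,.d],false,false⟩, ⟨⟨3,[.e,.v,.d,.v,.e]⟩,64,78,[.d,.u,.e],true,true⟩,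
  ⟨⟨1,[.v]⟩,46,109,[],false,false⟩, ⟨⟨2,[.v,.d,.u,.e,.u,.d,.u,.d,.v,.e]⟩,261,22,[.u,.e,.v,.e],true,false⟩,
  ⟨⟨2,[.v]⟩,47,109,[],false,false⟩, ⟨⟨3,[.v]⟩,46,109,[],false,false⟩,
  ⟨⟨2,[.e,.u,.d,.v,.e]⟩,401,7,[.d],false,true⟩, ⟨⟨3,[.e,.u,.d,.v,.e]⟩,390,5,[.d],false,true⟩,
  ⟨⟨2,[.d,.u,.d,.u,.e,.u]⟩,340,8,[],true,false⟩, ⟨⟨2,[.v,.e,.v,.d,.u,.e,.u]⟩,353,12,[.u,.d],false,false⟩,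
  ⟨⟨2,[.e,.u,.d,.u,.e]⟩,354,3,[.d,.v,.e],false,true⟩, ⟨⟨3,[.v,.e,.v,.d,.u,.e,.u]⟩,343,13,[.u,.d],false,false⟩,
  ⟨⟨3,[.e,.u,.d,.u,.e]⟩,344,4,[.d,.v,.e],false,true⟩, ⟨⟨2,[.d,.u,.d,.u,.u,.e,.u]⟩,4,397,[.e,.v,.e],false,true⟩,
  ⟨⟨2,[.v,.e,.v,.d,.v,.e,.u]⟩,409,4,[.u,.d,.u,.e],false,false⟩, ⟨⟨3,[.v,.e,.v,.d,.v,.e,.u]⟩,398,3,[.u,.d,.u,.e],false,false⟩,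
  ⟨⟨2,[.v,.d,.v,.e,.u,.d,.u,.d,.v,.e]⟩,196,12,[.u,.e],false,false⟩, ⟨⟨1,[.v,.d,.u,.d,.u,.e,.v,.e]⟩,14,155,[.u,.e,.v,.e],false,true⟩,
  ⟨⟨2,[.e,.u,.d,.u,.e,.v,.d]⟩,61,84,[.d,.v,.e],false,true⟩, ⟨⟨2,[.e,.u,.u,.d,.u,.u]⟩,39,111,[.d],false,true⟩,
  ⟨⟨3,[.d,.u,.d,.v,.e,.v,.e,.v,.d,.u]⟩,144,27,[.e,.v,.e],true,true⟩, ⟨⟨1,[.e,.u,.u,.d,.u,.u]⟩,43,108,[.d],false,true⟩,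
  ⟨⟨3,[.e,.u,.u,.d,.u,.u]⟩,43,112,[.d],false,true⟩, ⟨⟨2,[.d,.u,.d,.v,.e,.v,.e,.v,.d,.u]⟩,140,29,[.e,.v,.e],true,true⟩,
  ⟨⟨2,[.d,.v,.e,.v,.d,.v,.d]⟩,224,5,[.e],true,true⟩, ⟨⟨3,[.d,.v,.e,.v,.d,.u,.e,.u]⟩,37,111,[.e,.u,.d,.u,.e],false,true⟩,
  ⟨⟨2,[.d,.v,.e,.v,.d,.u,.e,.u]⟩,37,110,[.e,.u,.d,.u,.e],false,true⟩, ⟨⟨3,[.v,.d,.v,.e]⟩,21,112,[.u,.e],false,false⟩,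
  ⟨⟨3,[.d,.u,.d,.v,.e,.v,.e,.u,.d,.u]⟩,217,7,[.e,.v,.e,.u,.d,.u,.d],false,true⟩, ⟨⟨2,[.d,.v,.e,.v,.d,.u,.d]⟩,317,4,[.e,.u,.d,.u,.e],false,true⟩,
  ⟨⟨2,[.v,.d,.v,.e]⟩,41,100,[],false,false⟩, ⟨⟨2,[.d,.u,.d,.v,.e,.v,.e,.u,.d,.u]⟩,211,7,[.e,.v,.e,.u,.d,.u,.d],false,true⟩,
  ⟨⟨1,[.v,.d,.v,.e]⟩,29,108,[.u,.e],false,false⟩, ⟨⟨2,[.v,.e,.u,.d,.u,.d,.u]⟩,413,5,[.u,.e],true,false⟩,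
  ⟨⟨2,[.d,.v,.e,.u,.d,.u,.d]⟩,369,4,[.e,.u,.d],false,true⟩, ⟨⟨1,[.d,.u,.d,.u,.d,.u,.e,.v,.e]⟩,428,4,[],true,false⟩,
  ⟨⟨3,[.d,.u,.d,.u,.e,.v,.e,.u,.d,.u]⟩,361,7,[.e,.v,.e],false,true⟩, ⟨⟨2,[.d,.u,.d,.u,.e,.v,.e,.u,.d,.u]⟩,374,5,[.e,.v,.e],false,true⟩,
  ⟨⟨2,[.d,.u,.e,.u,.d,.u,.d]⟩,365,3,[.e],false,true⟩, ⟨⟨2,[.v,.e,.v,.d,.u,.d,.u]⟩,424,5,[.u,.d],false,false⟩,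
  ⟨⟨1,[.d,.u,.d,.u,.d,.v,.e,.v,.e]⟩,437,4,[.e,.v,.e,.v,.e],false,false⟩, ⟨⟨4,[.v,.e,.v,.d,.v,.e,.u,.d,.u]⟩,363,4,[],true,true⟩,
  ⟨⟨3,[.v,.e,.v,.d,.v,.e,.u,.d,.u]⟩,376,4,[],true,true⟩, ⟨⟨3,[.d,.v,.e,.v,.e,.u,.d,.u]⟩,55,91,[.e,.u,.d,.u,.d],false,true⟩,
  ⟨⟨2,[.d,.u,.d,.u,.e,.v,.d,.u,.e,.u]⟩,30,111,[.e,.v,.e,.v,.d],false,false⟩, ⟨⟨2,[.d,.v,.e,.v,.e,.u,.d,.u]⟩,56,92,[.e,.u,.d,.u,.d],false,true⟩]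

def steps6 : List Step := [
  ⟨⟨1,[.d,.u,.d,.u,.e,.u,.d,.u]⟩,218,6,[],true,false⟩, ⟨⟨1,[.v,.e,.v,.d,.v,.e,.u,.d,.u]⟩,91,56,[.u,.d,.u,.e],false,false⟩,
  ⟨⟨2,[.v,.e,.v,.d,.v,.e,.u,.d,.u]⟩,91,58,[.u,.d,.u,.e],false,false⟩, ⟨⟨0,[.d,.u,.d,.u,.e,.u,.d,.u]⟩,222,8,[.e,.v,.e,.v,.e],true,false⟩,
  ⟨⟨2,[.d,.u,.d,.u,.e,.v,.e,.u]⟩,113,34,[],true,false⟩, ⟨⟨1,[.d,.u,.d,.u,.e,.v,.e,.u]⟩,110,36,[],true,false⟩,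
  ⟨⟨3,[.d,.v,.e,.u,.d,.u,.e,.u]⟩,156,26,[.e,.u,.d],false,true⟩, ⟨⟨2,[.d,.v,.e,.u,.d,.u,.e,.u]⟩,158,26,[.e,.u,.d],false,true⟩,
  ⟨⟨2,[.v,.e,.v,.d,.u,.e,.u,.d,.u,.d,.u]⟩,59,99,[.u,.d],false,false⟩, ⟨⟨1,[.v,.e,.v,.d,.u,.e,.u,.d,.u,.d,.u]⟩,59,101,[.u,.d],false,false⟩,
  ⟨⟨2,[.d,.u,.d,.u,.e,.v,.d,.v,.e,.u]⟩,351,11,[.e,.v,.e,.v,.d,.u,.e],false,false⟩, ⟨⟨2,[.d,.v,.e,.v,.d]⟩,100,46,[.e],true,true⟩,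
  ⟨⟨3,[.d,.v,.e,.v,.d]⟩,99,45,[.e],true,true⟩, ⟨⟨1,[.d,.u,.d,.u,.e,.v,.e,.u,.d,.u]⟩,405,10,[],true,false⟩,
  ⟨⟨1,[.d,.u,.d,.v,.e,.u,.d,.u]⟩,314,13,[.e,.v,.e],false,false⟩, ⟨⟨3,[.d,.u,.d,.v,.e,.v]⟩,189,22,[.e,.v,.e],true,true⟩,
  ⟨⟨3,[.d,.v,.d,.v,.e,.v,.d,.u]⟩,375,9,[.e,.u,.e],true,true⟩, ⟨⟨2,[.d,.v,.d,.v,.e,.v,.d,.u]⟩,375,9,[.e,.u,.e],true,true⟩,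
  ⟨⟨0,[.d,.u,.d,.v,.e,.u,.d,.u]⟩,294,14,[.e,.v,.e],false,false⟩, ⟨⟨2,[.d,.v,.e,.u,.d]⟩,359,7,[.e,.u,.d],false,true⟩,
  ⟨⟨3,[.d,.v,.e,.u,.d]⟩,352,7,[.e,.u,.d],false,true⟩, ⟨⟨2,[.v,.e,.v,.d,.v,.e,.u,.d,.u,.d,.u]⟩,452,12,[.u,.d,.u,.e],false,false⟩,
  ⟨⟨1,[.v,.e,.v,.d,.v,.e,.u,.d,.u,.d,.u]⟩,465,12,[.u,.d,.u,.e],false,false⟩, ⟨⟨3,[.d,.u,.d,.u,.e,.v]⟩,382,7,[.e,.v,.e],false,true⟩,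
  ⟨⟨1,[.d,.u,.d,.v,.e,.v,.e,.u,.d,.u]⟩,419,10,[.e,.v,.e],false,false⟩, ⟨⟨3,[.d,.u,.e,.v,.d]⟩,265,12,[.e],false,true⟩,
  ⟨⟨3,[.d,.v,.d,.v,.e,.u,.d,.u]⟩,376,9,[.e,.u,.e,.u,.d],false,true⟩, ⟨⟨2,[.d,.u,.e,.u,.d]⟩,376,7,[.e],false,true⟩,
  ⟨⟨2,[.d,.v,.d,.v,.e,.u,.d,.u]⟩,383,10,[.e,.u,.e,.u,.d],false,true⟩, ⟨⟨3,[.d,.u,.e,.u,.d]⟩,448,3,[.e,.v,.d],false,true⟩,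
  ⟨⟨4,[.v,.e,.v,.d,.v]⟩,384,6,[],true,true⟩, ⟨⟨2,[.d,.v,.e,.u,.d,.u,.u]⟩,305,11,[.e,.u,.d,.v,.e],false,true⟩,
  ⟨⟨3,[.d,.v,.e,.u,.d,.u,.u]⟩,324,11,[.e,.u,.d,.v,.e],false,true⟩, ⟨⟨2,[.v,.d,.v,.e,.v,.d,.u,.d,.v,.e]⟩,115,62,[.u,.e,.u,.d],false,false⟩,
  ⟨⟨2,[.d,.u,.e,.u,.d,.u,.u]⟩,459,6,[.e,.v,.d,.v,.e],false,true⟩, ⟨⟨3,[.d,.u,.e,.v,.e,.u,.d,.u]⟩,197,37,[.e],false,true⟩,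
  ⟨⟨3,[.d,.u,.d,.v,.e,.u,.d,.u]⟩,404,9,[.e],false,true⟩, ⟨⟨3,[.d,.u,.e,.u,.d,.u,.u]⟩,450,7,[.e,.v,.d,.v,.e],false,true⟩,
  ⟨⟨2,[.d,.u,.d,.v,.e,.u,.d,.u]⟩,418,9,[.e],false,true⟩, ⟨⟨2,[.d,.v,.d,.u,.e,.u,.d,.u]⟩,417,10,[.e,.u,.e],false,true⟩,
  ⟨⟨2,[.d,.u,.e,.v,.e,.u,.d,.u]⟩,207,40,[.e],false,true⟩, ⟨⟨4,[.v,.e,.v,.d,.u]⟩,451,10,[.u,.d,.u,.e],false,true⟩,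
  ⟨⟨1,[.d,.u,.d,.v,.e,.v,.e,.v,.d,.u]⟩,269,17,[.e,.v,.e,.u,.d,.u,.d],false,false⟩, ⟨⟨4,[.v,.e,.v,.e,.u,.d,.u,.e,.v,.e]⟩,61,145,[.u,.d,.u,.d],false,true⟩,
  ⟨⟨1,[.d,.u,.d,.v,.e,.v,.e,.u]⟩,197,38,[.e,.v,.e],false,false⟩, ⟨⟨2,[.d,.u,.d,.v,.e,.v,.e,.u]⟩,196,40,[.e,.v,.e],false,false⟩,
  ⟨⟨3,[.d,.u,.e,.u,.e,.u,.d,.u]⟩,347,10,[.e,.v,.d],false,true⟩, ⟨⟨2,[.d,.u,.d,.u,.e,.u,.d,.u]⟩,373,7,[.e],false,true⟩,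
  ⟨⟨3,[.v,.e,.v,.e,.u,.d,.u,.e,.v,.e]⟩,63,149,[.u,.d,.u,.d],false,true⟩, ⟨⟨2,[.d,.u,.e,.u,.e,.u,.d,.u]⟩,344,8,[.e,.v,.d],false,true⟩,
  ⟨⟨0,[.d,.u,.e,.u,.d,.u,.u]⟩,449,5,[.e,.v,.e],true,false⟩, ⟨⟨1,[.d,.u,.e,.u,.d,.u,.u]⟩,438,5,[.e,.v,.e],true,false⟩,
  ⟨⟨1,[.d,.u,.e,.u,.d]⟩,489,0,[.e,.v,.d,.v,.e],false,false⟩, ⟨⟨0,[.d,.v,.e,.u,.d,.u,.u]⟩,459,2,[.e],false,false⟩,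
  ⟨⟨1,[.d,.v,.e,.u,.d,.u,.u]⟩,448,2,[.e],false,false⟩, ⟨⟨2,[.d,.u,.d,.u,.u,.e,.u,.d,.u]⟩,7,354,[.e,.v,.e],false,true⟩,
  ⟨⟨4,[.v,.e,.v,.e,.v,.d,.u,.e,.u,.d,.u]⟩,343,9,[],true,true⟩, ⟨⟨1,[.d,.u,.e,.v,.d]⟩,500,4,[.e,.v,.d],false,false⟩,
  ⟨⟨3,[.v,.e,.v,.e,.v,.d,.u,.e,.u,.d,.u]⟩,343,8,[],true,true⟩, ⟨⟨3,[.v,.e,.v,.d,.u,.d,.u]⟩,282,11,[],true,true⟩]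

def steps7 : List Step := [
  ⟨⟨3,[.v,.e,.u,.d,.u,.d,.u]⟩,479,0,[.u,.d],false,true⟩, ⟨⟨4,[.v,.e,.v,.e,.u,.d,.u,.e,.u,.d,.u]⟩,472,4,[.u,.d,.u,.d],false,true⟩,
  ⟨⟨3,[.v,.e,.v,.e,.u,.d,.u,.e,.u,.d,.u]⟩,485,3,[.u,.d,.u,.d],false,true⟩, ⟨⟨1,[.d,.u,.e,.u,.e,.u]⟩,227,20,[.e,.v,.e],true,false⟩,
  ⟨⟨1,[.v,.e,.v,.d,.v,.e,.v,.d,.u,.d,.u]⟩,198,41,[.u,.d,.u,.e,.u,.d],false,false⟩, ⟨⟨2,[.v,.e,.v,.d,.v,.e,.v,.d,.u,.d,.u]⟩,193,43,[.u,.d,.u,.e,.u,.d],false,false⟩,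
  ⟨⟨4,[.v,.d,.v,.e]⟩,480,5,[.u,.e],true,true⟩, ⟨⟨3,[.d,.u,.d,.v,.d,.v,.e,.v,.e]⟩,211,28,[.e,.v,.e,.u,.e],true,true⟩,
  ⟨⟨2,[.d,.u,.d,.v,.e,.v,.d,.v,.e,.u]⟩,177,57,[.e,.v,.e],false,false⟩, ⟨⟨1,[.d,.u,.e,.v,.e,.u]⟩,468,5,[.e,.v,.d],false,false⟩,
  ⟨⟨3,[.d,.u,.d,.u,.u,.d,.v,.e,.v,.e]⟩,269,14,[.e,.v,.e,.v,.v,.e],true,true⟩, ⟨⟨1,[.d,.v,.e,.v,.e,.u]⟩,521,1,[.e],false,false⟩,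
  ⟨⟨0,[.e,.u,.d,.u,.u]⟩,527,0,[.e],true,false⟩, ⟨⟨3,[.d,.u,.d,.u,.u,.d,.u,.e,.v,.e]⟩,421,2,[.e,.v,.e,.v,.v,.e],false,true⟩,
  ⟨⟨5,[.v,.e,.v,.e,.u,.d,.u,.e,.v,.e]⟩,441,0,[],true,true⟩, ⟨⟨2,[.d,.u,.e,.u,.d,.u,.e,.v,.e,.u]⟩,226,6,[.e,.v,.e],true,false⟩,
  ⟨⟨2,[.d,.u,.e,.u,.d,.v,.e,.v,.e,.u]⟩,463,0,[.e,.v,.d,.v,.e],false,false⟩, ⟨⟨1,[.d,.u,.e,.u,.e,.u,.d,.u,.u]⟩,514,0,[.e,.v,.d,.v,.e],true,false⟩,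
  ⟨⟨0,[.e,.u,.u,.d,.u,.u]⟩,5,217,[.d],false,true⟩, ⟨⟨2,[.v,.e,.u,.d,.u,.e,.u,.d,.v,.e]⟩,136,45,[.u,.e],true,false⟩,
  ⟨⟨2,[.v,.e,.u,.d,.u,.e,.v,.d,.v,.e]⟩,518,0,[.u,.d,.v,.e,.v,.d],false,false⟩, ⟨⟨1,[.v,.e,.v,.e,.u,.d,.u,.e,.u,.d,.u]⟩,171,16,[.u,.d,.u,.e],true,false⟩,
  ⟨⟨2,[.v,.e,.v,.e,.u,.d,.u,.e,.u,.d,.u]⟩,171,16,[.u,.d,.u,.e],true,false⟩, ⟨⟨2,[.v,.e,.u,.d,.v,.e,.v,.d,.v,.e]⟩,430,2,[.u,.d,.v,.e],false,false⟩,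
  ⟨⟨2,[.v,.e,.v,.e,.v,.d,.u,.e,.u,.d,.u]⟩,519,1,[.u,.d,.u,.d],false,false⟩, ⟨⟨2,[.v,.e,.u,.e,.u,.d,.u,.e,.v,.e]⟩,316,1,[.u,.d,.v,.e],true,false⟩,
  ⟨⟨3,[.d,.v,.e,.v,.e,.v,.e,.u,.d,.u,.u]⟩,54,112,[.e],true,true⟩, ⟨⟨4,[.d,.v,.e,.v,.e,.v,.e,.u,.d,.u,.u]⟩,54,110,[.e],true,true⟩,
  ⟨⟨1,[.d,.u,.e,.u,.e,.u,.d,.u]⟩,355,3,[],true,false⟩, ⟨⟨3,[.d,.u,.e,.v,.e,.v,.e,.u,.d,.u,.u]⟩,509,2,[.e],false,true⟩,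
  ⟨⟨4,[.d,.u,.e,.v,.e,.v,.e,.u,.d,.u,.u]⟩,498,2,[.e],false,true⟩, ⟨⟨2,[.d,.v,.e,.v,.e,.v,.e,.u,.d,.u,.u]⟩,36,115,[.e],true,true⟩,
  ⟨⟨2,[.d,.u,.e,.v,.e,.v,.e,.u,.d,.u,.u]⟩,524,0,[.e],false,true⟩, ⟨⟨2,[.v,.e,.v,.e,.u,.d,.u,.e,.v,.e]⟩,121,7,[.u,.d],false,false⟩,
  ⟨⟨1,[.d,.v,.e,.v,.e,.v,.e,.u,.d,.u,.u]⟩,40,15,[.e],true,true⟩, ⟨⟨1,[.d,.u,.e,.v,.e,.v,.e,.u,.d,.u,.u]⟩,539,0,[.e],false,true⟩,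
  ⟨⟨1,[.d,.u,.e,.u,.e,.u,.d]⟩,7,18,[.e,.v,.d,.v,.d,.v,.e],false,false⟩, ⟨⟨1,[.d,.u,.e,.v,.e,.u,.d]⟩,316,0,[.e,.v,.d],false,false⟩,
  ⟨⟨1,[.d,.u,.e,.v,.e,.v,.d]⟩,222,0,[.e,.v,.d,.u,.d],false,false⟩, ⟨⟨2,[.d,.u,.e,.v,.e,.u,.d,.v,.e,.v,.e]⟩,1,217,[.e,.v,.d,.u,.d,.v,.e],true,true⟩,
  ⟨⟨2,[.d,.u,.e,.v,.e,.u,.d,.u,.e,.v,.e]⟩,42,0,[.e,.v,.d,.u,.d,.v,.e],false,true⟩, ⟨⟨2,[.d,.u,.e,.v,.d,.v,.e,.v,.d,.v,.e]⟩,409,0,[.e,.v,.d,.u,.e],true,true⟩,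
  ⟨⟨2,[.d,.u,.e,.u,.d,.v,.e,.v,.d,.v,.e]⟩,117,0,[.e,.v,.d],false,true⟩, ⟨⟨2,[.d,.u,.e,.u,.d,.u,.e,.v,.d,.v,.e]⟩,192,0,[.e,.v,.d,.v,.e],false,true⟩,
  ⟨⟨2,[.d,.u,.d,.v,.e,.v,.d,.v,.d,.v,.e]⟩,245,0,[.e,.v,.e],true,true⟩, ⟨⟨2,[.d,.u,.d,.v,.e,.v,.d,.u,.d,.v,.e]⟩,281,0,[.e,.v,.e,.u,.d,.u,.e],false,true⟩,
  ⟨⟨2,[.d,.u,.d,.v,.e,.u,.d,.u,.d,.v,.e]⟩,533,0,[.e,.v,.e,.u,.d],false,true⟩, ⟨⟨3,[.d,.u,.d,.v,.d,.v,.e,.v,.v,.e]⟩,437,0,[.e,.v,.e,.u,.e],true,true⟩,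
  ⟨⟨2,[.d,.u,.d,.v,.d,.v,.d]⟩,40,0,[.e,.v,.e,.u,.e,.u,.d],false,true⟩, ⟨⟨2,[.d,.u,.d,.u,.d,.v,.d]⟩,83,0,[.e,.v,.e],false,true⟩,
  ⟨⟨4,[.v,.e,.v,.v,.d]⟩,460,0,[],true,true⟩, ⟨⟨4,[.v]⟩,521,0,[.u,.d],false,true⟩]

/-- The whole certificate. -/
def allSteps : List Step :=
  steps0 ++ steps1 ++ steps2 ++ steps3 ++ steps4 ++ steps5 ++ steps6 ++ steps7

def targetIdx : List ℕ := [
  565, 519, 566, 563, 561, 193, 418, 564, 562, 558, 360, 556, 364, 560, 42, 125, 559, 410, 557, 382,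
  61, 13, 356, 16, 155, 367, 332, 387, 110, 157, 431, 93, 511, 18, 30, 189, 553, 507, 554, 551,
  549, 188, 398, 552, 550, 546, 362, 544, 390, 548, 173, 127, 547, 427, 545, 394, 60, 223, 345, 19,
  153, 372, 328, 374, 109, 166, 409, 97, 499, 63, 29, 186, 541, 495, 542, 539, 537, 187, 425, 540,
  538, 534, 354, 532, 366, 536, 172, 130, 535, 417, 533, 373, 77, 220, 348, 22, 152, 401, 334, 370,
  115, 158, 442, 73, 487, 68, 49, 190, 529, 483, 530, 527, 525, 192, 389, 528, 526, 522, 355, 520,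
  400, 524, 171, 45, 523, 408, 521, 371, 74, 222, 346, 21, 0, 376, 327, 375, 116, 70, 435, 75,
  475, 37, 50, 191]


end Certificate

/-- Check that the products `gen · z^k · E m · h` appear at the given positions. -/
def checkTargets (K : List Elt) : List ℕ → List (Fin 4 × Fin 12 × Fin 3) → Bool
  | _, [] => true
  | [], _ :: _ => false
  | i :: L, (k, m, c) :: M =>
    match K[i]? with
    | some p => (p.eqb (stdElt k [c] m [])) && checkTargets K L M
    | none => false

lemma checkTargets_sound (K : List Elt) (hK : ∀ g ∈ K, Known g) :
    ∀ (L : List ℕ) (M : List (Fin 4 × Fin 12 × Fin 3)), checkTargets K L M = true →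
      ∀ p ∈ M, Known (stdElt p.1 [p.2.2] p.2.1 [])
  | _, [], _ => by simp
  | [], _ :: _, h => by cases h
  | i :: L, (k, m, c) :: M, h => by
    rw [checkTargets] at h
    split at h
    · rename_i p hp
      simp only [Bool.and_eq_true] at h
      intro x hx
      rcases List.mem_cons.1 hx with rfl | hx
      · rw [← Elt.eq_of_eqb h.1]
        exact hK _ (List.mem_of_getElem? hp)
      · exact checkTargets_sound K hK L M h.2 x hx
    · cases h

/-- All targets. -/
def targets : List (Fin 4 × Fin 12 × Fin 3) :=
  (List.finRange 4).flatMap fun k => (List.finRange 12).flatMap fun m =>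
    (List.finRange 3).map fun c => (k, m, c)

/-- The complete check. -/
def checkAll : Bool :=
  checkBase baseList baseIdx &&
    match run baseList.reverse allSteps with
    | some K => checkTargets K targetIdx targets
    | none => false

set_option maxRecDepth 100000 in
lemma checkAll_true : checkAll = true := by decide +kernel

lemma targets_known (k : Fin 4) (m : Fin 12) (c : Fin 3) : Known (stdElt k [c] m []) := by
  have h := checkAll_true
  rw [checkAll, Bool.and_eq_true] at h
  obtain ⟨h1, h2⟩ := h
  have hb := checkBase_sound _ _ h1
  split at h2
  · rename_i K hK
    have hKnown := run_sound _ _ K (fun g hg => hb g (List.mem_reverse.1 hg)) hK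
    exact checkTargets_sound K hKnown _ _ h2 (k, m, c) (by
      simp only [targets, List.mem_flatMap, List.mem_map]
      exact ⟨k, List.mem_finRange k, m, List.mem_finRange m, c, List.mem_finRange c, rfl⟩)
  · cases h2

/-! ### Conclusion -/

lemma z_gen (k : ℕ) (c : Fin 3) : (genVal c : H) * z ^ k = z ^ k * genVal c := by
  have hz : ∀ c, Commute zU (genVal c) := by
    intro c
    have hu : Commute zU uU := Ltr.comm .u
    have hd : Commute zU dU := Ltr.comm .d
    have ht : Commute zU tU := by
      rw [t_eq]
      exact (((hu.mul_right hd).mul_right hu).mul_right hd.inv_right).mul_right hu.inv_right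
    have hs : Commute zU sU := by
      rw [s_eq]
      exact ((((Commute.refl zU).mul_right hd.inv_right).mul_right hu.inv_right).mul_right
        hd.inv_right).mul_right hu.inv_right
    fin_cases c
    · exact hs
    · exact ht
    · exact hu
  have h := congrArg (Units.val) ((hz c).pow_left k).eq
  rw [Units.val_mul, Units.val_mul, Units.val_pow_eq_pow_val, val_z] at h
  exact h.symm

lemma gen_mul_E (c : Fin 3) (k : Fin 4) (m : Fin 12) :
    (genVal c : H) * (z ^ k.val * E m) ∈ Sp := by
  have h := targets_known k m c
  rw [Known, stdElt_val] at h
  rw [← mul_assoc, z_gen]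
  simpa [gensVal] using h

lemma B_eq (i : Fin 96) : ∃ (k : Fin 4) (m : Fin 12) (l : Fin 2),
    B i = z ^ k.val * E m * t ^ l.val :=
  ⟨⟨i / 24, by omega⟩, ⟨i % 12, by omega⟩, ⟨i / 12 % 2, by omega⟩, rfl⟩

lemma mul_t_mem (x : H) (hx : x ∈ Sp) : x * t ∈ Sp := by
  induction hx using Submodule.span_induction with
  | mem x hx =>
    obtain ⟨i, rfl⟩ := hx
    obtain ⟨k, m, l, h⟩ := B_eq i
    rw [h]
    have h0 := std_mem k m 0
    have h1 := std_mem k m 1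
    fin_cases l
    · simpa using h1
    · simp only [Fin.mk_one, Fin.val_one, pow_one, mul_assoc, Fin.val_zero, pow_zero,
        mul_one] at h0 h1 ⊢
      rw [t_sq]
      simp only [mul_add, mul_smul_comm, mul_one]
      exact Sp.add_mem (Sp.smul_mem _ h1) (Sp.smul_mem _ h0)
  | zero => simp
  | add x y _ _ hx hy => rw [add_mul]; exact Sp.add_mem hx hy
  | smul r x _ hx => rw [smul_mul_assoc]; exact Sp.smul_mem _ hx

lemma gen_mul_mem (c : Fin 3) (x : H) (hx : x ∈ Sp) : (genVal c : H) * x ∈ Sp := by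
  induction hx using Submodule.span_induction with
  | mem x hx =>
    obtain ⟨i, rfl⟩ := hx
    obtain ⟨k, m, l, h⟩ := B_eq i
    rw [h, ← mul_assoc]
    have h0 := gen_mul_E c k m
    fin_cases l
    · simpa using h0
    · simpa using mul_t_mem _ h0
  | zero => simp
  | add x y _ _ hx hy => rw [mul_add]; exact Sp.add_mem hx hy
  | smul r x _ hx => rw [mul_smul_comm]; exact Sp.smul_mem _ hx

lemma gen_eq (c : Fin 3) : RingQuot.mkAlgHom Rr Rel (FreeAlgebra.ι Rr c) = genVal c := by
  fin_cases c <;> rfl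

lemma all_mul_mem (f : FreeAlgebra Rr (Fin 3)) :
    ∀ x ∈ Sp, RingQuot.mkAlgHom Rr Rel f * x ∈ Sp := by
  induction f using FreeAlgebra.induction with
  | grade0 r =>
    intro x hx
    rw [map_sc, ← Algebra.smul_def]
    exact Sp.smul_mem _ hx
  | grade1 c =>
    intro x hx
    rw [gen_eq]
    exact gen_mul_mem c x hx
  | mul f g hf hg =>
    intro x hx
    rw [map_mul, mul_assoc]
    exact hf _ (hg _ hx)
  | add f g hf hg =>
    intro x hx
    rw [map_add, add_mul]
    exact Sp.add_mem (hf _ hx) (hg _ hx)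

/-- The family `B₁₃` spans `H` as an `R`-module. -/
theorem stmt1 : Submodule.span Rr (Set.range B) = ⊤ := by
  rw [Submodule.eq_top_iff']
  intro x
  obtain ⟨f, rfl⟩ := RingQuot.mkAlgHom_surjective Rr Rel x
  have h1 : (1 : H) ∈ Sp := by
    have h := std_mem 0 0 0
    simpa [E] using h
  have h := all_mul_mem f 1 h1
  rwa [mul_one] at h

end G13
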